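/- There exist a constant a > 0 and a family of unsatisfiable 3-CNF formulas F_N over N variables, with a number of clauses polynomial in N, such that: (i) for all sufficiently large N, F_N admits a resolution refutation of size at most N^{a·log N}; and (ii) for every constant c > 0 there exist ε > 0 and N_0 such that for all N ≥ N_0, every resolution refutation of F_N of depth at most N^c has size at least 2^{N^ε}. -/

import Mathlib

namespace Paper


/-! ### Clauses, CNFs and resolution refutations -/

/-- A clause: a finite set of literals (variable, polarity), read as a disjunction. -/
abbrev Clause (V : Type) := Finset (V × Bool)

/-- An assignment satisfies a clause if it satisfies some literal of it. -/
def SatC {V : Type} (α : V → Bool) (C : Clause V) : Prop := ∃ l ∈ C, α l.1 = l.2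

/-- A set of clauses is unsatisfiable. -/
def Unsat {V : Type} (F : Set (Clause V)) : Prop := ∀ α : V → Bool, ∃ C ∈ F, ¬ SatC α C

/-- A resolution refutation of `F`: a sequence of clauses ending in the empty clause,
each clause either in `F` or obtained from two earlier clauses by the resolution rule
(the premises being recorded in `prem`). -/
structure Refutation (V : Type) [DecidableEq V] (F : Set (Clause V)) where
  size : ℕ
  size_pos : 0 < size
  clause : Fin size → Clause V
  prem : Fin size → Option (Fin size × Fin size × V)
  ok : ∀ i : Fin size,
    match prem i with
    | none => clause i ∈ F
    | some (j, k, x) =>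
        j < i ∧ k < i ∧ (x, true) ∈ clause j ∧ (x, false) ∈ clause k ∧
          clause i = (clause j).erase (x, true) ∪ (clause k).erase (x, false)
  last_empty : clause ⟨size - 1, Nat.sub_lt size_pos Nat.one_pos⟩ = ∅

/-- The refutation has width at most `w`. -/
def WidthLE {V : Type} [DecidableEq V] {F : Set (Clause V)}
    (R : Refutation V F) (w : ℕ) : Prop :=
  ∀ i, (R.clause i).card ≤ w

/-- The refutation has depth (longest path in the derivation DAG) at most `d`,
witnessed by a height function. -/
def DepthLE {V : Type} [DecidableEq V] {F : Set (Clause V)}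
    (R : Refutation V F) (d : ℕ) : Prop :=
  ∃ h : Fin R.size → ℕ, (∀ i, h i ≤ d) ∧
    ∀ i j k x, R.prem i = some (j, k, x) → h j < h i ∧ h k < h i

/-! ### Bracket configurations -/

/-- Two chords are either disjoint or strictly nested. -/
def Compat (z y : ℕ × ℕ) : Prop :=
  z.2 < y.1 ∨ y.2 < z.1 ∨ (z.1 < y.1 ∧ y.2 < z.2) ∨ (y.1 < z.1 ∧ z.2 < y.2)

/-- A set of pairwise compatible chords on the points `0, …, n - 1`,
each joining two points of different parity. -/
structure Legal (n : ℕ) (K : Finset (ℕ × ℕ)) : Prop where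
  lt : ∀ z ∈ K, z.1 < z.2
  bound : ∀ z ∈ K, z.2 < n
  parity : ∀ z ∈ K, (z.1 + z.2) % 2 = 1
  compat : ∀ z ∈ K, ∀ y ∈ K, z ≠ y → Compat z y

/-- The point `k` lies under some chord of `K`. -/
def Covered (K : Finset (ℕ × ℕ)) (k : ℕ) : Prop := ∃ c ∈ K, c.1 ≤ k ∧ k ≤ c.2

lemma Legal.mono {n : ℕ} {K K' : Finset (ℕ × ℕ)} (h : Legal n K) (hs : K' ⊆ K) : Legal n K' :=
  ⟨fun z hz => h.lt z (hs hz), fun z hz => h.bound z (hs hz), fun z hz => h.parity z (hs hz),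
    fun z hz z' hz' => h.compat z (hs hz) z' (hs hz')⟩

lemma Covered.mono {K K' : Finset (ℕ × ℕ)} {k : ℕ} (h : Covered K' k) (hs : K' ⊆ K) :
    Covered K k := by
  obtain ⟨c, hc, h⟩ := h
  exact ⟨c, hs hc, h⟩

lemma Legal.empty (n : ℕ) : Legal n ∅ := by constructor <;> simp

lemma Legal.insert_chord {n : ℕ} {K : Finset (ℕ × ℕ)} {z : ℕ × ℕ} (h : Legal n K) (hlt : z.1 < z.2)
    (hb : z.2 < n) (hp : (z.1 + z.2) % 2 = 1) (hc : ∀ c ∈ K, Compat z c) :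
    Legal n (insert z K) := by
  refine ⟨?_, ?_, ?_, ?_⟩
  · intro c hc'
    rcases Finset.mem_insert.1 hc' with rfl | hc'
    exacts [hlt, h.lt c hc']
  · intro c hc'
    rcases Finset.mem_insert.1 hc' with rfl | hc'
    exacts [hb, h.bound c hc']
  · intro c hc'
    rcases Finset.mem_insert.1 hc' with rfl | hc'
    exacts [hp, h.parity c hc']
  · intro c hc₁ y hc₂ hne
    rcases Finset.mem_insert.1 hc₁ with h₁ | h₁ <;> rcases Finset.mem_insert.1 hc₂ with h₂ | h₂
    · exact absurd (h₁.trans h₂.symm) hne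
    · exact h₁ ▸ hc y h₂
    · have := hc c h₁
      subst h₂
      unfold Compat at *
      omega
    · exact h.compat c h₁ y h₂ hne

/-- An interval tiled by chords has even length. -/
lemma Legal.even_of_tiled {n : ℕ} {K : Finset (ℕ × ℕ)} (hK : Legal n K) (m : ℕ) :
    ∀ a b : ℕ, b - a = m → a ≤ b →
      (∀ k, a ≤ k → k < b → ∃ c ∈ K, c.1 ≤ k ∧ k ≤ c.2 ∧ a ≤ c.1 ∧ c.2 < b) →
      (b - a) % 2 = 0 := by
  induction m using Nat.strong_induction_on with
  | _ m ih =>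
    intro a b hm hab hcov
    rcases Nat.eq_or_lt_of_le hab with rfl | hlt
    · simp
    obtain ⟨c, hc, h1, h2, h3, h4⟩ := hcov a le_rfl hlt
    have hclt := hK.lt c hc
    have hcp := hK.parity c hc
    have := ih (b - (c.2 + 1)) (by omega) (c.2 + 1) b rfl (by omega) (by
      intro k hk hkb
      obtain ⟨c', hc', g1, g2, g3, g4⟩ := hcov k (by omega) hkb
      refine ⟨c', hc', g1, g2, ?_, g4⟩
      have hne : c ≠ c' := by rintro rfl; omega
      have := hK.compat c hc c' hc' hne
      have := hK.lt c' hc'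
      unfold Compat at *
      omega)
    omega

/-- In an interval of even length that is respected by all chords, each exposed point can be
joined to an adjacent exposed point. -/
lemma Legal.exists_partner {n : ℕ} {K : Finset (ℕ × ℕ)} (hK : Legal n K) {lo hi i : ℕ}
    (hpar : (hi - lo) % 2 = 0) (hlo : lo ≤ i) (hhi : i < hi)
    (hi' : ∀ c ∈ K, lo ≤ c.1 → c.2 < hi → ¬ (c.1 ≤ i ∧ i ≤ c.2)) :
    ∃ p q, p < q ∧ lo ≤ p ∧ q < hi ∧ (p = i ∨ q = i) ∧ p % 2 = lo % 2 ∧ (p + q) % 2 = 1 ∧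
      (∀ c ∈ K, lo ≤ c.1 → c.2 < hi → ¬ (c.1 ≤ p ∧ p ≤ c.2) ∧ ¬ (c.1 ≤ q ∧ q ≤ c.2)) ∧
      (∀ k, p < k → k < q → ∃ c ∈ K, c.1 ≤ k ∧ k ≤ c.2 ∧ lo ≤ c.1 ∧ c.2 < hi) := by
  classical
  by_cases hip : i % 2 = lo % 2
  · -- join to the next exposed point
    have hex : ∃ q, i < q ∧ q < hi ∧ ∀ c ∈ K, lo ≤ c.1 → c.2 < hi → ¬ (c.1 ≤ q ∧ q ≤ c.2) := by
      by_contra hcon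
      push Not at hcon
      have := hK.even_of_tiled _ (i + 1) hi rfl (by omega) (by
        intro k hk hkb
        obtain ⟨c, hc, h1, h2, h3, h4⟩ := hcon k (by omega) hkb
        refine ⟨c, hc, h3, h4, ?_, h2⟩
        have := hi' c hc h1 h2
        omega)
      omega
    have hfind := Nat.find_spec hex
    have hmin := fun k (hk : k < Nat.find hex) => Nat.find_min hex hk
    generalize Nat.find hex = q at hfind hmin
    obtain ⟨hq1, hq2, hq3⟩ := hfind
    have hbetween : ∀ k, i < k → k < q → ∃ c ∈ K, c.1 ≤ k ∧ k ≤ c.2 ∧ lo ≤ c.1 ∧ c.2 < hi := by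
      intro k hk hkq
      have := hmin k hkq
      push Not at this
      obtain ⟨c, hc, h1, h2, h3, h4⟩ := this hk (by omega)
      exact ⟨c, hc, h3, h4, h1, h2⟩
    have := hK.even_of_tiled _ (i + 1) q rfl (by omega) (by
      intro k hk hkq
      obtain ⟨c, hc, h1, h2, h3, h4⟩ := hbetween k (by omega) hkq
      have := hi' c hc h3 h4
      have := hq3 c hc h3 h4
      exact ⟨c, hc, h1, h2, by omega, by omega⟩)
    exact ⟨i, q, hq1, hlo, hq2, Or.inl rfl, hip, by omega,
      fun c hc h1 h2 => ⟨hi' c hc h1 h2, hq3 c hc h1 h2⟩, hbetween⟩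
  · -- join to the previous exposed point
    have hex : ∃ r, r < i - lo ∧
        ∀ c ∈ K, lo ≤ c.1 → c.2 < hi → ¬ (c.1 ≤ i - 1 - r ∧ i - 1 - r ≤ c.2) := by
      by_contra hcon
      push Not at hcon
      have := hK.even_of_tiled _ lo i rfl (by omega) (by
        intro k hk hkb
        obtain ⟨c, hc, h1, h2, h3, h4⟩ := hcon (i - 1 - k) (by omega)
        have := hi' c hc h1 h2
        exact ⟨c, hc, by omega, by omega, h1, by omega⟩)
      omega
    have hfind := Nat.find_spec hex
    have hmin := fun k (hk : k < Nat.find hex) => Nat.find_min hex hk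
    generalize Nat.find hex = r at hfind hmin
    obtain ⟨hq1, hq3⟩ := hfind
    have hbetween : ∀ k, i - 1 - r < k → k < i →
        ∃ c ∈ K, c.1 ≤ k ∧ k ≤ c.2 ∧ lo ≤ c.1 ∧ c.2 < hi := by
      intro k hk hkq
      have := hmin (i - 1 - k) (by omega)
      push Not at this
      obtain ⟨c, hc, h1, h2, h3, h4⟩ := this (by omega)
      exact ⟨c, hc, by omega, by omega, h1, h2⟩
    have := hK.even_of_tiled _ (i - 1 - r + 1) i rfl (by omega) (by
      intro k hk hkq
      obtain ⟨c, hc, h1, h2, h3, h4⟩ := hbetween k (by omega) hkq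
      have := hi' c hc h3 h4
      have := hq3 c hc h3 h4
      exact ⟨c, hc, h1, h2, by omega, by omega⟩)
    exact ⟨i - 1 - r, i, by omega, by omega, hhi, Or.inr rfl, by omega, by omega,
      fun c hc h1 h2 => ⟨hq3 c hc h1 h2, hi' c hc h1 h2⟩, hbetween⟩

lemma compat_of_exposed {K : Finset (ℕ × ℕ)} {n lo hi p q : ℕ} (hK : Legal n K)
    (hpq : p < q) (hlo : lo ≤ p) (hhi : q < hi)
    (hresp : ∀ c ∈ K, c.2 < lo ∨ hi ≤ c.1 ∨ (lo ≤ c.1 ∧ c.2 < hi) ∨ (c.1 < lo ∧ hi ≤ c.2))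
    (hexp : ∀ c ∈ K, lo ≤ c.1 → c.2 < hi → ¬ (c.1 ≤ p ∧ p ≤ c.2) ∧ ¬ (c.1 ≤ q ∧ q ≤ c.2)) :
    ∀ c ∈ K, Compat (p, q) c := by
  intro c hc
  have h1 := hresp c hc
  have h2 := hexp c hc
  have h3 := hK.lt c hc
  unfold Compat
  dsimp only
  omega

/-- The chord `z` is an admissible answer when the defect is at `d`: it is already present, or
strictly inside a chord, or it joins two consecutive exposed points on one side of `d`, with
endpoints of the right parity. -/
def Answer (K : Finset (ℕ × ℕ)) (d : ℕ) (z : ℕ × ℕ) : Prop :=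
  z ∈ K ∨ (∃ c ∈ K, c.1 < z.1 ∧ z.2 < c.2) ∨
    (¬ Covered K z.1 ∧ ¬ Covered K z.2 ∧ (∀ k, z.1 < k → k < z.2 → Covered K k) ∧
      ((z.2 < d ∧ z.1 % 2 = 0) ∨ (d < z.1 ∧ z.1 % 2 = 1)))

lemma Legal.exists_answer {n : ℕ} {K : Finset (ℕ × ℕ)} (hK : Legal n K) (hn : n % 2 = 1) {d i : ℕ}
    (hd : d % 2 = 0) (hdn : d < n) (hcov : ¬ Covered K d) (hi : i < n) (hne : i ≠ d) :
    ∃ z : ℕ × ℕ, (z.1 = i ∨ z.2 = i) ∧ Legal n (insert z K) ∧ Answer K d z := by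
  classical
  by_cases hend : ∃ z ∈ K, z.1 = i ∨ z.2 = i
  · obtain ⟨z, hz, h⟩ := hend
    exact ⟨z, h, by rwa [Finset.insert_eq_of_mem hz], Or.inl hz⟩
  push Not at hend
  by_cases hci : Covered K i
  · -- a shortest chord above `i`
    obtain ⟨c₀, hc₀, h₀⟩ := hci
    obtain ⟨c, hc, hmin⟩ := Finset.exists_min_image (K.filter fun c => c.1 ≤ i ∧ i ≤ c.2)
      (fun c => c.2 - c.1) ⟨c₀, by simp [hc₀, h₀]⟩
    simp only [Finset.mem_filter, and_imp] at hc hmin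
    obtain ⟨hcK, hc1, hc2⟩ := hc
    have hec := hend c hcK
    have hclt := hK.lt c hcK
    have hcp := hK.parity c hcK
    have hcb := hK.bound c hcK
    have hresp : ∀ c' ∈ K, c'.2 < c.1 + 1 ∨ c.2 ≤ c'.1 ∨ (c.1 + 1 ≤ c'.1 ∧ c'.2 < c.2) ∨
        (c'.1 < c.1 + 1 ∧ c.2 ≤ c'.2) := by
      intro c' hc'
      by_cases h : c = c'
      · subst h; omega
      · have := hK.compat c hcK c' hc' h
        have := hK.lt c' hc'
        unfold Compat at *
        omega
    obtain ⟨p, q, g1, g2, g3, g4, g5, g6, g7, g8⟩ := hK.exists_partner (lo := c.1 + 1) (hi := c.2)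
      (i := i) (by omega) (by omega) (by omega) (by
        intro c' hc' h1 h2 h3
        have := hmin c' hc' h3.1 h3.2
        omega)
    refine ⟨(p, q), g4, hK.insert_chord g1 ?_ g6 (compat_of_exposed hK g1 g2 g3 hresp g7),
      Or.inr (Or.inl ⟨c, hcK, ?_, g3⟩)⟩
    all_goals dsimp only; omega
  · have hunc : ∀ x, ¬ Covered K x → ∀ c ∈ K, ¬ (c.1 ≤ x ∧ x ≤ c.2) :=
      fun x hx c hc h => hx ⟨c, hc, h⟩
    have hdc := hunc d hcov
    have hic := hunc i hci
    rcases Nat.lt_or_gt_of_ne hne with hlt | hgt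
    · have hresp : ∀ c ∈ K, c.2 < 0 ∨ d ≤ c.1 ∨ (0 ≤ c.1 ∧ c.2 < d) ∨ (c.1 < 0 ∧ d ≤ c.2) := by
        intro c hc
        have := hdc c hc
        omega
      obtain ⟨p, q, g1, g2, g3, g4, g5, g6, g7, g8⟩ := hK.exists_partner (lo := 0) (hi := d)
        (i := i) (by omega) (by omega) hlt (fun c hc _ _ => hic c hc)
      refine ⟨(p, q), g4, hK.insert_chord g1 (by dsimp only; omega) g6
        (compat_of_exposed hK g1 g2 g3 hresp g7), Or.inr (Or.inr ⟨?_, ?_, ?_, ?_⟩)⟩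
      · rintro ⟨c, hc, h⟩
        have := hdc c hc
        have := g7 c hc
        dsimp only at h
        omega
      · rintro ⟨c, hc, h⟩
        have := hdc c hc
        have := g7 c hc
        dsimp only at h
        omega
      · intro k h1 h2
        obtain ⟨c, hc, h3, h4, _⟩ := g8 k h1 h2
        exact ⟨c, hc, h3, h4⟩
      · left
        dsimp only
        omega
    · have hresp : ∀ c ∈ K, c.2 < d + 1 ∨ n ≤ c.1 ∨ (d + 1 ≤ c.1 ∧ c.2 < n) ∨
          (c.1 < d + 1 ∧ n ≤ c.2) := by
        intro c hc
        have := hdc c hc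
        have := hK.bound c hc
        omega
      obtain ⟨p, q, g1, g2, g3, g4, g5, g6, g7, g8⟩ := hK.exists_partner (lo := d + 1) (hi := n)
        (i := i) (by omega) (by omega) hi (fun c hc _ _ => hic c hc)
      refine ⟨(p, q), g4, hK.insert_chord g1 (by dsimp only; omega) g6
        (compat_of_exposed hK g1 g2 g3 hresp g7), Or.inr (Or.inr ⟨?_, ?_, ?_, ?_⟩)⟩
      · rintro ⟨c, hc, h⟩
        have := hdc c hc
        have := g7 c hc
        have := hK.bound c hc
        dsimp only at h
        omega
      · rintro ⟨c, hc, h⟩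
        have := hdc c hc
        have := g7 c hc
        have := hK.bound c hc
        dsimp only at h
        omega
      · intro k h1 h2
        obtain ⟨c, hc, h3, h4, _⟩ := g8 k h1 h2
        exact ⟨c, hc, h3, h4⟩
      · right
        dsimp only
        omega

/-! ### The adversary strategy -/

/-- An adversary remembering at most `w` chords at a time can survive `t` more rounds
starting from the chords `K`. -/
def Alive (n w : ℕ) : ℕ → Finset (ℕ × ℕ) → Prop
  | 0, K => Legal n K
  | t + 1, K => Legal n K ∧ ∀ K' ⊆ K, K'.card ≤ w → ∀ i < n, ∃ z : ℕ × ℕ,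
      (z.1 = i ∨ z.2 = i) ∧ Alive n w t (insert z K')

lemma Alive.legal {n w t : ℕ} {K : Finset (ℕ × ℕ)} (h : Alive n w t K) : Legal n K := by
  cases t with
  | zero => exact h
  | succ t => exact h.1

lemma alive_of_small {n w t : ℕ} {K : Finset (ℕ × ℕ)} (hK : Legal n K)
    (h : ∀ K' ⊆ K, K'.card ≤ w → Alive n w t K') : Alive n w t K := by
  cases t with
  | zero => exact hK
  | succ t => exact ⟨hK, fun K' hs hc => (h K' hs hc).2 K' subset_rfl hc⟩

/-- The chord sets reachable from `K₀` by forgetting chords and by giving answers with the defect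
moving inside the arena `[x, y]`. -/
inductive Reach (n x y : ℕ) (K₀ : Finset (ℕ × ℕ)) : Finset (ℕ × ℕ) → Prop
  | refl : Reach n x y K₀ K₀
  | subset {K K' : Finset (ℕ × ℕ)} : Reach n x y K₀ K → K' ⊆ K → Reach n x y K₀ K'
  | step {K : Finset (ℕ × ℕ)} {z : ℕ × ℕ} (d : ℕ) : Reach n x y K₀ K → x ≤ d → d ≤ y →
      d % 2 = 0 → ¬ Covered K d → Answer K d z → Legal n (insert z K) →
      Reach n x y K₀ (insert z K)

lemma Reach.trans {n x y x' y' : ℕ} {K₀ K₁ K₂ : Finset (ℕ × ℕ)} (hx : x ≤ x') (hy : y' ≤ y)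
    (h₁ : Reach n x y K₀ K₁) (h₂ : Reach n x' y' K₁ K₂) : Reach n x y K₀ K₂ := by
  induction h₂ with
  | refl => exact h₁
  | subset _ hs ih => exact ih.subset hs
  | step d _ hd₁ hd₂ hp hc ha hl ih => exact ih.step d (by omega) (by omega) hp hc ha hl

lemma Reach.legal {n x y : ℕ} {K₀ K : Finset (ℕ × ℕ)} (h₀ : Legal n K₀) (h : Reach n x y K₀ K) :
    Legal n K := by
  induction h with
  | refl => exact h₀
  | subset _ hs ih => exact ih.mono hs
  | step d _ _ _ _ _ _ hl ih => exact hl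

/-- No chord of `K` reaches over a point of `[x, y]`. -/
def Fresh (x y : ℕ) (K : Finset (ℕ × ℕ)) : Prop := ∀ c ∈ K, c.2 < x ∨ y < c.1

/-- The shape of a chord created while the defect stays inside the arena `[x, y]`. -/
def ArenaShape (x y : ℕ) (K₀ : Finset (ℕ × ℕ)) (z : ℕ × ℕ) : Prop :=
  (x ≤ z.1 ∧ z.2 ≤ y) ∨
  (z.2 < x ∧ ((∀ k, z.1 ≤ k → k ≤ z.2 → Covered K₀ k) ∨
    (z.1 % 2 = 0 ∧ ∀ k, z.1 < k → k < z.2 → Covered K₀ k))) ∨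
  (y < z.1 ∧ ((∀ k, z.1 ≤ k → k ≤ z.2 → Covered K₀ k) ∨
    (z.1 % 2 = 1 ∧ ∀ k, z.1 < k → k < z.2 → Covered K₀ k)))

lemma Legal.exists_maximal_cover {n : ℕ} {K : Finset (ℕ × ℕ)} (hK : Legal n K) {k : ℕ}
    (h : Covered K k) : ∃ c ∈ K, c.1 ≤ k ∧ k ≤ c.2 ∧
      ∀ c' ∈ K, c' = c ∨ c'.2 < c.1 ∨ c.2 < c'.1 ∨ (c.1 < c'.1 ∧ c'.2 < c.2) := by
  classical
  obtain ⟨c₀, hc₀, h₀⟩ := h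
  obtain ⟨c, hc, hmax⟩ := Finset.exists_max_image (K.filter fun c => c.1 ≤ k ∧ k ≤ c.2)
    (fun c => c.2 - c.1) ⟨c₀, by simp [hc₀, h₀]⟩
  simp only [Finset.mem_filter, and_imp] at hc hmax
  refine ⟨c, hc.1, hc.2.1, hc.2.2, fun c' hc' => ?_⟩
  by_cases he : c' = c
  · exact Or.inl he
  have h1 := hK.compat c hc.1 c' hc' (Ne.symm he)
  have h2 := hmax c' hc'
  have h3 := hK.lt c' hc'
  unfold Compat at h1
  omega

lemma Reach.arenaShape {n x y : ℕ} {K₀ K : Finset (ℕ × ℕ)} (hx : x % 2 = 0) (hy : y % 2 = 0)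
    (h₀ : Legal n K₀) (hf : Fresh x y K₀) (h : Reach n x y K₀ K) :
    ∀ z ∈ K, ArenaShape x y K₀ z := by
  induction h with
  | refl =>
    intro z hz
    have := hf z hz
    have hz' : ∀ k, z.1 ≤ k → k ≤ z.2 → Covered K₀ k := fun k h1 h2 => ⟨z, hz, h1, h2⟩
    rcases this with h | h
    · exact Or.inr (Or.inl ⟨h, Or.inl hz'⟩)
    · exact Or.inr (Or.inr ⟨h, Or.inl hz'⟩)
  | subset _ hs ih => exact fun z hz => ih z (hs hz)
  | @step K z d hr hd₁ hd₂ hp hc ha hl ih =>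
    have hK := hr.legal h₀
    have hzlt := hl.lt z (Finset.mem_insert_self _ _)
    have hzp := hl.parity z (Finset.mem_insert_self _ _)
    intro z' hz'
    rcases Finset.mem_insert.1 hz' with rfl | hz'
    swap
    · exact ih z' hz'
    rcases ha with ha | ⟨c, hcK, hc1, hc2⟩ | ⟨hu1, hu2, hin, hside⟩
    · exact ih _ ha
    · rcases ih c hcK with h | ⟨h, h'⟩ | ⟨h, h'⟩
      · exact Or.inl ⟨by omega, by omega⟩
      · refine Or.inr (Or.inl ⟨by omega, Or.inl fun k h1 h2 => ?_⟩)
        rcases h' with h' | ⟨-, h'⟩ <;> exact h' k (by omega) (by omega)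
      · refine Or.inr (Or.inr ⟨by omega, Or.inl fun k h1 h2 => ?_⟩)
        rcases h' with h' | ⟨-, h'⟩ <;> exact h' k (by omega) (by omega)
    · have hu1' : ∀ c ∈ K, ¬ (c.1 ≤ z'.1 ∧ z'.1 ≤ c.2) := fun c hc h => hu1 ⟨c, hc, h⟩
      have hu2' : ∀ c ∈ K, ¬ (c.1 ≤ z'.2 ∧ z'.2 ≤ c.2) := fun c hc h => hu2 ⟨c, hc, h⟩
      rcases hside with ⟨hs1, hs2⟩ | ⟨hs1, hs2⟩
      · by_cases hxz : x ≤ z'.1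
        · exact Or.inl ⟨hxz, by omega⟩
        by_cases hxz2 : x ≤ z'.2
        · exfalso
          have := hK.even_of_tiled _ (z'.1 + 1) x rfl (by omega) (by
            intro k hk1 hk2
            obtain ⟨c, hcK, h1, h2⟩ := hin k (by omega) (by omega)
            have h3 := hu1' c hcK
            have h4 := ih c hcK
            have h5 := hK.lt c hcK
            refine ⟨c, hcK, h1, h2, by omega, ?_⟩
            rcases h4 with h | ⟨h, -⟩ | ⟨h, -⟩ <;> omega)
          omega
        · refine Or.inr (Or.inl ⟨by omega, Or.inr ⟨hs2, fun k hk1 hk2 => ?_⟩⟩)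
          obtain ⟨c, hcK, h1, h2, hmax⟩ := hK.exists_maximal_cover (hin k hk1 hk2)
          rcases ih c hcK with h | ⟨h, h' | ⟨h', -⟩⟩ | ⟨h, -⟩
          · omega
          · exact h' k h1 h2
          · exfalso
            have h3 := hu1' c hcK
            have h4 := hu2' c hcK
            have := hK.even_of_tiled _ (z'.1 + 1) c.1 rfl (by omega) (by
              intro k' hk1' hk2'
              obtain ⟨c', hcK', g1, g2⟩ := hin k' (by omega) (by omega)
              have g3 := hu1' c' hcK'
              refine ⟨c', hcK', g1, g2, by omega, ?_⟩
              rcases hmax c' hcK' with rfl | g | g | g <;> omega)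
            omega
          · omega
      · by_cases hxz : z'.2 ≤ y
        · exact Or.inl ⟨by omega, hxz⟩
        by_cases hxz2 : z'.1 ≤ y
        · exfalso
          have := hK.even_of_tiled _ (y + 1) z'.2 rfl (by omega) (by
            intro k hk1 hk2
            obtain ⟨c, hcK, h1, h2⟩ := hin k (by omega) (by omega)
            have h3 := hu2' c hcK
            have h4 := ih c hcK
            have h5 := hK.lt c hcK
            refine ⟨c, hcK, h1, h2, ?_, by omega⟩
            rcases h4 with h | ⟨h, -⟩ | ⟨h, -⟩ <;> omega)
          omega
        · refine Or.inr (Or.inr ⟨by omega, Or.inr ⟨hs2, fun k hk1 hk2 => ?_⟩⟩)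
          obtain ⟨c, hcK, h1, h2, hmax⟩ := hK.exists_maximal_cover (hin k hk1 hk2)
          rcases ih c hcK with h | ⟨h, -⟩ | ⟨h, h' | ⟨h', -⟩⟩
          · omega
          · omega
          · exact h' k h1 h2
          · exfalso
            have h3 := hu1' c hcK
            have h4 := hu2' c hcK
            have h5 := hK.parity c hcK
            have := hK.even_of_tiled _ (c.2 + 1) z'.2 rfl (by omega) (by
              intro k' hk1' hk2'
              obtain ⟨c', hcK', g1, g2⟩ := hin k' (by omega) (by omega)
              have g3 := hu2' c' hcK'
              refine ⟨c', hcK', g1, g2, ?_, by omega⟩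
              rcases hmax c' hcK' with rfl | g | g | g <;> omega)
            omega

/-- Outside the arena, only endpoints of chords become newly covered. -/
lemma Reach.covered {n x y : ℕ} {K₀ K : Finset (ℕ × ℕ)} (hx : x % 2 = 0) (hy : y % 2 = 0)
    (h₀ : Legal n K₀) (hf : Fresh x y K₀) (h : Reach n x y K₀ K) {k : ℕ} (hk : Covered K k) :
    (x ≤ k ∧ k ≤ y) ∨ Covered K₀ k ∨ k ∈ K.image Prod.fst ∪ K.image Prod.snd := by
  obtain ⟨c, hc, h1, h2⟩ := hk
  have hend : k = c.1 ∨ k = c.2 → k ∈ K.image Prod.fst ∪ K.image Prod.snd := by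
    rintro (rfl | rfl)
    · exact Finset.mem_union_left _ (Finset.mem_image_of_mem _ hc)
    · exact Finset.mem_union_right _ (Finset.mem_image_of_mem _ hc)
  by_cases he : k = c.1 ∨ k = c.2
  · exact Or.inr (Or.inr (hend he))
  rcases h.arenaShape hx hy h₀ hf c hc with h | ⟨-, h | ⟨-, h⟩⟩ | ⟨-, h | ⟨-, h⟩⟩
  · exact Or.inl ⟨by omega, by omega⟩
  all_goals exact Or.inr (Or.inl (h k (by omega) (by omega)))

/-- The length (minus one) of an arena of level `l`. -/
def arenaSpan (w E : ℕ) : ℕ → ℕ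
  | 0 => 2
  | l + 1 => w * (arenaSpan w E l + (2 * w * E + 2)) + arenaSpan w E l

lemma arenaSpan_even (w E l : ℕ) : arenaSpan w E l % 2 = 0 := by
  induction l with
  | zero => simp [arenaSpan]
  | succ l ih =>
    obtain ⟨r, hr⟩ : 2 ∣ arenaSpan w E l := Nat.dvd_of_mod_eq_zero ih
    refine Nat.mod_eq_zero_of_dvd ⟨w * (r + (w * E + 1)) + r, ?_⟩
    rw [arenaSpan, hr]
    ring

lemma arenaSpan_add (w E l : ℕ) :
    arenaSpan w E l + (2 * w * E + 2) = (w + 1) ^ l * (2 * w * E + 4) := by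
  induction l with
  | zero => simp [arenaSpan]; ring
  | succ l ih => rw [pow_succ, mul_right_comm _ (w + 1), ← ih, arenaSpan]; ring

/-- If few points outside the sub-arenas are covered, some sub-arena is fresh. -/
lemma exists_fresh {w E s x e : ℕ} {K : Finset (ℕ × ℕ)} (hw : K.card ≤ w) {X : Finset ℕ}
    (hX : X.card + 2 * w * e ≤ 2 * w * E)
    (hcov : ∀ k, x ≤ k → k ≤ x + (w * (s + (2 * w * E + 2)) + s) → Covered K k →
      (∃ j, x + j * (s + (2 * w * E + 2)) ≤ k ∧ k ≤ x + j * (s + (2 * w * E + 2)) + s) ∨ k ∈ X) :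
    ∃ j ≤ w, Fresh (x + j * (s + (2 * w * E + 2))) (x + j * (s + (2 * w * E + 2)) + s) K := by
  classical
  set D := s + (2 * w * E + 2) with hD
  by_contra hcon
  push Not at hcon
  have hmeet : ∀ j, j ≤ w → ∃ c ∈ K, x + j * D ≤ c.2 ∧ c.1 ≤ x + j * D + s := by
    intro j hj
    have := hcon j hj
    unfold Fresh at this
    push Not at this
    exact this
  choose! f hf using hmeet
  have hno : ∀ j j', j < j' → j' ≤ w → f j ≠ f j' := by
    intro j j' hlt hj' heq
    have h1 := hf j (by omega)
    have h2 := hf j' hj'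
    rw [← heq] at h2
    have hjD : (j + 1) * D ≤ j' * D := Nat.mul_le_mul_right _ hlt
    have hwD : j' * D ≤ w * D := Nat.mul_le_mul_right _ hj'
    have hsub : Finset.Icc (x + j * D + s + 1) (x + j * D + s + (2 * w * E + 1)) ⊆ X := by
      intro k hk
      rw [Finset.mem_Icc] at hk
      rw [Nat.add_mul] at hjD
      rcases hcov k (by omega) (by omega) ⟨f j, h1.1, by omega, by omega⟩ with ⟨i, hi1, hi2⟩ | hk'
      · exfalso
        rcases Nat.lt_or_ge j i with hij | hij
        · have : (j + 1) * D ≤ i * D := Nat.mul_le_mul_right _ hij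
          rw [Nat.add_mul] at this
          omega
        · have : i * D ≤ j * D := Nat.mul_le_mul_right _ hij
          omega
      · exact hk'
    have := Finset.card_le_card hsub
    rw [Nat.card_Icc] at this
    omega
  obtain ⟨j, hj, j', hj', hne, heq⟩ := Finset.exists_ne_map_eq_of_card_lt_of_maps_to
    (s := Finset.range (w + 1)) (t := K) (f := f) (by simpa using Nat.lt_succ_of_le hw)
    (fun j hj => (hf j (by simp at hj; omega)).1)
  simp only [Finset.mem_range] at hj hj'
  rcases Nat.lt_or_gt_of_ne hne with h | h
  · exact hno j j' h (by omega) heq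
  · exact hno j' j h (by omega) heq.symm

/-- In a fresh arena of level `l`, the adversary survives `E ^ l` rounds. -/
lemma alive_of_arena {n w E : ℕ} (hn : n % 2 = 1) (l : ℕ) : ∀ (t x : ℕ) (K₀ : Finset (ℕ × ℕ)),
    x % 2 = 0 → x + arenaSpan w E l < n → Legal n K₀ → Fresh x (x + arenaSpan w E l) K₀ →
    (∀ K, Reach n x (x + arenaSpan w E l) K₀ K → Alive n w t K) → Alive n w (t + E ^ l) K₀ := by
  classical
  induction l with
  | zero =>
    intro t x K₀ hx hxn h₀ hf H
    simp only [arenaSpan] at *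
    refine ⟨h₀, fun K' hK' _ i hi => ?_⟩
    have hunc : ∀ d, x ≤ d → d ≤ x + 2 → ¬ Covered K' d := by
      rintro d h1 h2 ⟨c, hc, h3, h4⟩
      have := hf c (hK' hc)
      omega
    obtain ⟨d, hd1, hd2, hd3, hd4⟩ : ∃ d, x ≤ d ∧ d ≤ x + 2 ∧ d % 2 = 0 ∧ i ≠ d := by
      by_cases h : i = x
      · exact ⟨x + 2, by omega, by omega, by omega, by omega⟩
      · exact ⟨x, by omega, by omega, by omega, h⟩
    obtain ⟨z, hz1, hz2, hz3⟩ := (h₀.mono hK').exists_answer hn hd3 (by omega) (hunc d hd1 hd2)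
      hi hd4
    exact ⟨z, hz1, H _ ((Reach.refl.subset hK').step d hd1 hd2 hd3 (hunc d hd1 hd2) hz3 hz2)⟩
  | succ l ihl =>
    intro t x K₀ hx hxn h₀ hf H
    have hev := arenaSpan_even w E l
    rw [arenaSpan] at hxn hf H
    have key : ∀ e K, Reach n x (x + (w * (arenaSpan w E l + (2 * w * E + 2)) + arenaSpan w E l))
        K₀ K → K.card ≤ w → (∃ X : Finset ℕ, X.card + 2 * w * e ≤ 2 * w * E ∧
          ∀ k, x ≤ k → k ≤ x + (w * (arenaSpan w E l + (2 * w * E + 2)) + arenaSpan w E l) →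
            Covered K k → (∃ j, x + j * (arenaSpan w E l + (2 * w * E + 2)) ≤ k ∧
              k ≤ x + j * (arenaSpan w E l + (2 * w * E + 2)) + arenaSpan w E l) ∨ k ∈ X) →
        Alive n w (t + e * E ^ l) K := by
      intro e
      induction e with
      | zero => intro K hK _ _; simpa using H K hK
      | succ e ihe =>
        rintro K hK hw ⟨X, hX, hcov⟩
        obtain ⟨j, hj, hfresh⟩ := exists_fresh hw hX hcov
        have hjD := Nat.mul_le_mul_right (arenaSpan w E l + (2 * w * E + 2)) hj
        have hjev : (x + j * (arenaSpan w E l + (2 * w * E + 2))) % 2 = 0 := by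
          obtain ⟨r, hr⟩ := Nat.dvd_of_mod_eq_zero hev
          obtain ⟨r', hr'⟩ := Nat.dvd_of_mod_eq_zero hx
          refine Nat.mod_eq_zero_of_dvd ⟨r' + j * (r + (w * E + 1)), ?_⟩
          rw [hr, hr']
          ring
        have := ihl (t + e * E ^ l) _ K hjev (by omega) (hK.legal h₀) hfresh (by
          intro K'' hK''
          refine alive_of_small (hK''.legal (hK.legal h₀)) fun K' hs hw' => ?_
          have hK' := hK''.subset hs
          refine ihe K' (hK.trans (by omega) (by omega) hK') hw'
            ⟨X ∪ (K'.image Prod.fst ∪ K'.image Prod.snd), ?_, ?_⟩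
          · have h1 := Finset.card_union_le X (K'.image Prod.fst ∪ K'.image Prod.snd)
            have h2 := Finset.card_union_le (K'.image Prod.fst) (K'.image Prod.snd)
            have h3 := Finset.card_image_le (s := K') (f := Prod.fst)
            have h4 := Finset.card_image_le (s := K') (f := Prod.snd)
            rw [Nat.mul_add] at hX
            omega
          · intro k hk1 hk2 hk
            rcases hK'.covered hjev (by omega) (hK.legal h₀) hfresh hk with h | h | h
            · exact Or.inl ⟨j, h⟩
            · rcases hcov k hk1 hk2 h with h | h
              · exact Or.inl h
              · exact Or.inr (Finset.mem_union_left _ h)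
            · exact Or.inr (Finset.mem_union_right _ h))
        rwa [Nat.add_mul, one_mul, ← Nat.add_assoc]
    rw [pow_succ, mul_comm (E ^ l)]
    refine alive_of_small h₀ fun K' hs hw => key E K' (Reach.refl.subset hs) hw ⟨∅, by simp, ?_⟩
    rintro k hk1 hk2 ⟨c, hc, h1, h2⟩
    have := hf c (hs hc)
    omega

lemma alive_empty {n w E l : ℕ} (hn : n % 2 = 1) (h : (w + 1) ^ l * (2 * w * E + 4) ≤ n) :
    Alive n w (E ^ l) ∅ := by
  have := arenaSpan_add w E l
  have := alive_of_arena (w := w) (E := E) hn l 0 0 ∅ rfl (by omega) (Legal.empty n)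
    (by simp [Fresh]) (fun K hK => hK.legal (Legal.empty n))
  simpa using this

/-! ### The lifted formula -/

section Gadget

variable {V : Type} {m : ℕ}

/-- Variables of the lifted formula: for each variable and copy, two shares (`some _`) and a
connector to the next copy (`none`); for each clause, pattern and position an auxiliary variable. -/
abbrev Gad (V : Type) (m : ℕ) : Type :=
  (V × Fin (m * 3) × Option Bool) ⊕ (Fin m × (Fin 3 → Bool) × Fin 3)

instance [DecidableEq V] : DecidableEq (Gad V m) := instDecidableEqSum

/-- The cyclic successor. -/
def next {M : ℕ} (κ : Fin M) : Fin M := ⟨(κ + 1) % M, Nat.mod_lt _ κ.pos⟩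

/-- The copy reserved for the `j`-th literal of the `k`-th clause. -/
def pos (k : Fin m) (j : Fin 3) : Fin (m * 3) := finProdFinEquiv (k, j)

variable [DecidableEq V]

/-- One of the clauses expressing that a connector is the sum of two consecutive shares. -/
def linkClause (v : V) (κ : Fin (m * 3)) (s A B : Bool) : Clause (Gad V m) :=
  {(Sum.inl (v, κ, some s), !A), (Sum.inl (v, next κ, some s), !B), (Sum.inl (v, κ, none), A ^^ B)}

/-- If the shares at the `j`-th literal falsify it following the pattern `D`, then the auxiliary
variable is true. -/
def patternClause (C : Fin m → Fin 3 → V × Bool) (k : Fin m) (D : Fin 3 → Bool) (j : Fin 3) :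
    Clause (Gad V m) :=
  {(Sum.inl ((C k j).1, pos k j, some true), !D j),
    (Sum.inl ((C k j).1, pos k j, some false), D j ^^ (C k j).2), (Sum.inr (k, D, j), true)}

/-- Not all three auxiliary variables are true. -/
def capClause (V : Type) [DecidableEq V] (k : Fin m) (D : Fin 3 → Bool) : Clause (Gad V m) :=
  {(Sum.inr (k, D, 0), false), (Sum.inr (k, D, 1), false), (Sum.inr (k, D, 2), false)}

/-- The lifted formula. -/
def lifted [Fintype V] (C : Fin m → Fin 3 → V × Bool) : Finset (Clause (Gad V m)) :=
  (Finset.univ.image fun a : V × Fin (m * 3) × Bool × Bool × Bool =>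
      linkClause a.1 a.2.1 a.2.2.1 a.2.2.2.1 a.2.2.2.2) ∪
    (Finset.univ.image fun a : Fin m × (Fin 3 → Bool) × Fin 3 =>
      patternClause C a.1 a.2.1 a.2.2) ∪
    (Finset.univ.image fun a : Fin m × (Fin 3 → Bool) => capClause V a.1 a.2)

variable [Fintype V]

lemma link_mem_lifted (C : Fin m → Fin 3 → V × Bool) (v : V) (κ : Fin (m * 3)) (s A B : Bool) :
    linkClause v κ s A B ∈ lifted C :=
  Finset.mem_union_left _ (Finset.mem_union_left _
    (Finset.mem_image.2 ⟨(v, κ, s, A, B), Finset.mem_univ _, rfl⟩))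

lemma pattern_mem_lifted (C : Fin m → Fin 3 → V × Bool) (k : Fin m) (D : Fin 3 → Bool)
    (j : Fin 3) : patternClause C k D j ∈ lifted C :=
  Finset.mem_union_left _ (Finset.mem_union_right _
    (Finset.mem_image.2 ⟨(k, D, j), Finset.mem_univ _, rfl⟩))

lemma cap_mem_lifted (C : Fin m → Fin 3 → V × Bool) (k : Fin m) (D : Fin 3 → Bool) :
    capClause V k D ∈ lifted C :=
  Finset.mem_union_right _ (Finset.mem_image.2 ⟨(k, D), Finset.mem_univ _, rfl⟩)

lemma mem_lifted {C : Fin m → Fin 3 → V × Bool} {c : Clause (Gad V m)} (h : c ∈ lifted C) :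
    (∃ v κ s A B, c = linkClause v κ s A B) ∨ (∃ k D j, c = patternClause C k D j) ∨
      ∃ k D, c = capClause V k D := by
  rcases Finset.mem_union.1 h with h | h
  · rcases Finset.mem_union.1 h with h | h
    · obtain ⟨a, -, rfl⟩ := Finset.mem_image.1 h
      exact Or.inl ⟨_, _, _, _, _, rfl⟩
    · obtain ⟨a, -, rfl⟩ := Finset.mem_image.1 h
      exact Or.inr (Or.inl ⟨_, _, _, rfl⟩)
  · obtain ⟨a, -, rfl⟩ := Finset.mem_image.1 h
    exact Or.inr (Or.inr ⟨_, _, rfl⟩)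

lemma card_le_three_of_mem_lifted {C : Fin m → Fin 3 → V × Bool} {c : Clause (Gad V m)}
    (h : c ∈ lifted C) : c.card ≤ 3 := by
  rcases mem_lifted h with ⟨v, κ, s, A, B, rfl⟩ | ⟨k, D, j, rfl⟩ | ⟨k, D, rfl⟩ <;>
    exact Finset.card_le_three

end Gadget

/-! ### Restrictions of the lifted formula -/

section Restriction

variable {V : Type} {m : ℕ}

/-- The pattern `D` is broken at position `j` by the constant share. -/
def broken (C : Fin m → Fin 3 → V × Bool) (ρ : V × Fin (m * 3) → Bool × Bool) (k : Fin m)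
    (D : Fin 3 → Bool) (j : Fin 3) : Prop :=
  (ρ ((C k j).1, pos k j)).2 ≠
    if (ρ ((C k j).1, pos k j)).1 then D j else (D j ^^ !(C k j).2)

open Classical in
/-- The restriction given by `ρ`: each block `(v, κ)` has a share of constant value, the other
share being `v` up to negation. A value `inr (v, b)` stands for the sum of `v` and `b`. -/
noncomputable def restrict (C : Fin m → Fin 3 → V × Bool) (ρ : V × Fin (m * 3) → Bool × Bool) :
    Gad V m → Bool ⊕ (V × Bool)
  | Sum.inl (v, κ, some s) =>
      if (ρ (v, κ)).1 = s then Sum.inl (ρ (v, κ)).2 else Sum.inr (v, (ρ (v, κ)).2)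
  | Sum.inl (v, κ, none) =>
      if (ρ (v, κ)).1 = (ρ (v, next κ)).1 then Sum.inl ((ρ (v, κ)).2 ^^ (ρ (v, next κ)).2)
      else Sum.inr (v, (ρ (v, κ)).2 ^^ (ρ (v, next κ)).2)
  | Sum.inr (k, D, j) =>
      if ∃ j', broken C ρ k D j' then
        Sum.inl (!decide (broken C ρ k D j ∧ ∀ j' < j, ¬ broken C ρ k D j'))
      else Sum.inr (C k j)

/-- The image of a literal under a substitution. -/
def litImage {X : Type} (σ : X → Bool ⊕ (V × Bool)) (l : X × Bool) : Bool ⊕ (V × Bool) :=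
  match σ l.1 with
  | Sum.inl b => Sum.inl (b == l.2)
  | Sum.inr (v, b) => Sum.inr (v, l.2 ^^ b)

/-- Each clause of the lifted formula is mapped to a tautology or to a weakening of an original
clause. -/
lemma restrict_lifted [DecidableEq V] [Fintype V] (C : Fin m → Fin 3 → V × Bool)
    (ρ : V × Fin (m * 3) → Bool × Bool) {c : Clause (Gad V m)} (hc : c ∈ lifted C) :
    (∃ l ∈ c, litImage (restrict C ρ) l = Sum.inl true) ∨
    (∃ v, ∀ b, ∃ l ∈ c, litImage (restrict C ρ) l = Sum.inr (v, b)) ∨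
    (∃ k, ∀ j, ∃ l ∈ c, litImage (restrict C ρ) l = Sum.inr (C k j)) := by
  rcases mem_lifted hc with ⟨v, κ, s, A, B, rfl⟩ | ⟨k, D, j, rfl⟩ | ⟨k, D, rfl⟩
  · have h : (∃ l ∈ linkClause v κ s A B, litImage (restrict C ρ) l = Sum.inl true) ∨
        (∀ b, ∃ l ∈ linkClause v κ s A B, litImage (restrict C ρ) l = Sum.inr (v, b)) := by
      simp only [linkClause, Finset.mem_insert, Finset.mem_singleton, exists_eq_or_imp,
        exists_eq_left, litImage, restrict]
      generalize ρ (v, κ) = r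
      generalize ρ (v, next κ) = r'
      obtain ⟨τ, b⟩ := r
      obtain ⟨τ', b'⟩ := r'
      revert τ τ' b b' s A B
      simp
    exact h.imp_right fun h => Or.inl ⟨v, h⟩
  · have h : (∃ l ∈ patternClause C k D j, litImage (restrict C ρ) l = Sum.inl true) ∨
        (∀ b, ∃ l ∈ patternClause C k D j,
          litImage (restrict C ρ) l = Sum.inr ((C k j).1, b)) := by
      by_cases hb : broken C ρ k D j
      · left
        unfold broken at hb
        simp only [patternClause, Finset.mem_insert, Finset.mem_singleton, exists_eq_or_imp,
          exists_eq_left, litImage, restrict]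
        revert hb
        generalize ρ ((C k j).1, pos k j) = r
        obtain ⟨τ, b⟩ := r
        generalize D j = d
        generalize (C k j).2 = e
        cases τ <;> cases b <;> cases d <;> cases e <;> simp
      · by_cases he : ∃ j', broken C ρ k D j'
        · left
          refine ⟨(Sum.inr (k, D, j), true), by simp [patternClause], ?_⟩
          simp [litImage, restrict, he, hb]
        · right
          simp only [patternClause, Finset.mem_insert, Finset.mem_singleton, exists_eq_or_imp,
            exists_eq_left, litImage, restrict, he, if_false]
          revert hb
          unfold broken
          generalize ρ ((C k j).1, pos k j) = r
          obtain ⟨τ, b⟩ := r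
          generalize D j = d
          generalize C k j = e
          obtain ⟨e₁, e⟩ := e
          cases τ <;> cases b <;> cases d <;> cases e <;> simp
    exact h.imp_right fun h => Or.inl ⟨_, h⟩
  · by_cases he : ∃ j', broken C ρ k D j'
    · left
      obtain ⟨j, hj, hmin⟩ : ∃ j, broken C ρ k D j ∧ ∀ j' < j, ¬ broken C ρ k D j' := by
        obtain ⟨j₀, hj₀⟩ := he
        have := WellFounded.has_min (wellFounded_lt (α := Fin 3)) {j | broken C ρ k D j} ⟨j₀, hj₀⟩
        obtain ⟨j, hj, hmin⟩ := this
        exact ⟨j, hj, fun j' hlt hb => hmin j' hb hlt⟩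
      refine ⟨(Sum.inr (k, D, j), false), ?_, ?_⟩
      · fin_cases j <;> simp [capClause]
      · simp only [litImage, restrict, if_pos he]
        simpa [hj] using hmin
    · right; right
      refine ⟨k, fun j => ⟨(Sum.inr (k, D, j), false), ?_, ?_⟩⟩
      · fin_cases j <;> simp [capClause]
      · simp [litImage, restrict, he]

end Restriction

/-! ### Random restrictions shorten wide clauses -/

section Counting

variable {L B : Type} [DecidableEq L] [DecidableEq B]

/-- A large set of literals, each supported on few blocks, with few literals per block, contains
many literals with disjoint supports. -/
lemma exists_disjoint_family {γ : Type} [Fintype γ] (hγ : Fintype.card γ ≤ 56)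
    (supp : L → Finset B) (hsupp : ∀ l, (supp l).card ≤ 3) (hne : ∀ l, (supp l).Nonempty)
    (touch : γ → B → L) (htouch : ∀ l, ∀ β ∈ supp l, ∃ g, touch g β = l)
    {S : Finset L} {r : ℕ} (hS : 168 * r ≤ S.card) :
    ∃ T ⊆ S, T.card = r ∧ ∀ l ∈ T, ∀ l' ∈ T, l ≠ l' → Disjoint (supp l) (supp l') := by
  classical
  obtain ⟨T, hT, hmax⟩ := Finset.exists_max_image
    (S.powerset.filter fun T => ∀ l ∈ T, ∀ l' ∈ T, l ≠ l' → Disjoint (supp l) (supp l'))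
    Finset.card ⟨∅, by simp⟩
  simp only [Finset.mem_filter, Finset.mem_powerset, and_imp] at hT hmax
  obtain ⟨hTS, hdis⟩ := hT
  have hmeet : ∀ l ∈ S, ∃ l' ∈ T, ¬ Disjoint (supp l) (supp l') := by
    intro l hl
    by_contra hcon
    push Not at hcon
    have hlT : l ∉ T := fun h => by
      have := hcon l h
      rw [disjoint_self] at this
      exact (hne l).ne_empty this
    have := hmax (insert l T) (Finset.insert_subset hl hTS) (by
      intro a ha b hb hab
      rcases Finset.mem_insert.1 ha with ha | ha <;> rcases Finset.mem_insert.1 hb with hb | hb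
      · exact absurd (ha.trans hb.symm) hab
      · exact ha ▸ hcon b hb
      · exact hb ▸ (hcon a ha).symm
      · exact hdis a ha b hb hab)
    rw [Finset.card_insert_of_notMem hlT] at this
    omega
  have hsub : S ⊆ (Finset.univ ×ˢ T.biUnion supp).image fun a : γ × B => touch a.1 a.2 := by
    intro l hl
    obtain ⟨l', hl', hd⟩ := hmeet l hl
    obtain ⟨β, hβ, hβ'⟩ := Finset.not_disjoint_iff.1 hd
    obtain ⟨g, hg⟩ := htouch l β hβ
    exact Finset.mem_image.2 ⟨(g, β), by simpa using ⟨l', hl', hβ'⟩, hg⟩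
  have h1 := (Finset.card_le_card hsub).trans Finset.card_image_le
  rw [Finset.card_product, Finset.card_univ] at h1
  have h2 : (T.biUnion supp).card ≤ T.card * 3 :=
    Finset.card_biUnion_le_card_mul _ _ _ fun l _ => hsupp l
  have h3 := Nat.mul_le_mul hγ h2
  obtain ⟨T', hT', hc⟩ := Finset.exists_subset_card_eq (s := T) (n := r) (by omega)
  exact ⟨T', hT'.trans hTS, hc, fun l hl l' hl' => hdis l (hT' hl) l' (hT' hl')⟩

variable [Fintype B]

/-- The number of block assignments avoiding all the prescribed local assignments. -/
lemma card_avoid_le (supp : L → Finset B) (hsupp : ∀ l, (supp l).card ≤ 3)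
    (α : L → B → Bool × Bool) (T : Finset L) :
    (∀ l ∈ T, ∀ l' ∈ T, l ≠ l' → Disjoint (supp l) (supp l')) →
    (Finset.univ.filter fun ρ : B → Bool × Bool =>
      ∀ l ∈ T, ¬ ∀ β ∈ supp l, ρ β = α l β).card * 64 ^ T.card ≤
      Fintype.card (B → Bool × Bool) * 63 ^ T.card := by
  classical
  induction T using Finset.induction_on with
  | empty => intro _; simp
  | insert l T hl ih =>
    intro hdis
    have ih := ih fun a ha b hb => hdis a (Finset.mem_insert_of_mem ha) b (Finset.mem_insert_of_mem hb)
    set A := Finset.univ.filter fun ρ : B → Bool × Bool =>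
      ∀ l ∈ T, ¬ ∀ β ∈ supp l, ρ β = α l β with hA
    have hsplit : (Finset.univ.filter fun ρ : B → Bool × Bool =>
        ∀ l' ∈ insert l T, ¬ ∀ β ∈ supp l', ρ β = α l' β) =
        A.filter fun ρ => ¬ ∀ β ∈ supp l, ρ β = α l β := by
      ext ρ
      simp only [hA, Finset.mem_filter, Finset.mem_univ, true_and, Finset.forall_mem_insert]
      exact and_comm
    have hadd := Finset.card_filter_add_card_filter_not (s := A)
      (fun ρ => ∀ β ∈ supp l, ρ β = α l β)
    let f : (B → Bool × Bool) → B → Bool × Bool := fun ρ β => if β ∈ supp l then α l β else ρ β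
    have h64 : A.card ≤ 64 * (A.image f).card := by
      refine Finset.card_le_mul_card_image A 64 fun a _ => ?_
      have : (A.filter fun ρ => f ρ = a).card ≤
          (Finset.univ : Finset (supp l → Bool × Bool)).card := by
        refine Finset.card_le_card_of_injOn (fun ρ β => ρ β) (fun _ _ => Finset.mem_univ _) ?_
        intro ρ hρ ρ' hρ' heq
        simp only [Finset.coe_filter, Set.mem_ofPred_eq] at hρ hρ'
        funext β
        by_cases hβ : β ∈ supp l
        · exact congrFun heq ⟨β, hβ⟩
        · have := congrFun (hρ.2.trans hρ'.2.symm) β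
          simpa [f, hβ] using this
      refine this.trans ?_
      rw [Finset.card_univ, Fintype.card_fun, Fintype.card_coe]
      calc Fintype.card (Bool × Bool) ^ (supp l).card ≤ 4 ^ 3 :=
            Nat.pow_le_pow_right (by norm_num) (hsupp l)
        _ = 64 := by norm_num
    have himg : A.image f ⊆ A.filter fun ρ => ∀ β ∈ supp l, ρ β = α l β := by
      intro ρ' hρ'
      obtain ⟨ρ, hρ, rfl⟩ := Finset.mem_image.1 hρ'
      simp only [hA, Finset.mem_filter, Finset.mem_univ, true_and] at hρ ⊢
      refine ⟨fun l' hl' hall => hρ l' hl' fun β hβ => ?_, fun β hβ => by simp [f, hβ]⟩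
      have hd := hdis l (Finset.mem_insert_self _ _) l' (Finset.mem_insert_of_mem hl')
        (fun h => hl (h ▸ hl'))
      have hβ' : β ∉ supp l := fun h => Finset.disjoint_left.1 hd h hβ
      simpa [f, hβ'] using hall β hβ
    have himg' := Finset.card_le_card himg
    rw [hsplit, Finset.card_insert_of_notMem hl, pow_succ, pow_succ]
    set a := (A.filter fun ρ => ¬ ∀ β ∈ supp l, ρ β = α l β).card
    have ha : a * 64 ≤ A.card * 63 := by omega
    calc a * (64 ^ T.card * 64) = (a * 64) * 64 ^ T.card := by ring
      _ ≤ (A.card * 63) * 64 ^ T.card := Nat.mul_le_mul_right _ ha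
      _ = (A.card * 64 ^ T.card) * 63 := by ring
      _ ≤ (Fintype.card (B → Bool × Bool) * 63 ^ T.card) * 63 := Nat.mul_le_mul_right _ ih
      _ = _ := by ring

/-- If there are not too many sets of literals, some block assignment realises one of the
prescribed local assignments in each large set. -/
lemma exists_assignment {γ : Type} [Fintype γ] (hγ : Fintype.card γ ≤ 56)
    (supp : L → Finset B) (hsupp : ∀ l, (supp l).card ≤ 3) (hne : ∀ l, (supp l).Nonempty)
    (touch : γ → B → L) (htouch : ∀ l, ∀ β ∈ supp l, ∃ g, touch g β = l)
    (α : L → B → Bool × Bool) {s r : ℕ} (S : Fin s → Finset L) (hs : s * 63 ^ r < 64 ^ r) :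
    ∃ ρ : B → Bool × Bool, ∀ i, 168 * r ≤ (S i).card →
      ∃ l ∈ S i, ∀ β ∈ supp l, ρ β = α l β := by
  classical
  by_contra hcon
  push Not at hcon
  have hbad : ∀ i, ((Finset.univ.filter fun ρ : B → Bool × Bool => 168 * r ≤ (S i).card ∧
      ∀ l ∈ S i, ¬ ∀ β ∈ supp l, ρ β = α l β).card) * 64 ^ r ≤
      Fintype.card (B → Bool × Bool) * 63 ^ r := by
    intro i
    by_cases hi : 168 * r ≤ (S i).card
    · obtain ⟨T, hTS, hc, hdis⟩ := exists_disjoint_family hγ supp hsupp hne touch htouch hi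
      have := card_avoid_le supp hsupp α T hdis
      rw [hc] at this
      refine le_trans (Nat.mul_le_mul_right _ (Finset.card_le_card ?_)) this
      intro ρ hρ
      simp only [Finset.mem_filter, Finset.mem_univ, true_and] at hρ ⊢
      exact fun l hl => hρ.2 l (hTS hl)
    · simp [hi]
  have hcover : (Finset.univ : Finset (B → Bool × Bool)) ⊆ Finset.univ.biUnion fun i : Fin s =>
      Finset.univ.filter fun ρ : B → Bool × Bool => 168 * r ≤ (S i).card ∧
        ∀ l ∈ S i, ¬ ∀ β ∈ supp l, ρ β = α l β := by
    intro ρ _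
    obtain ⟨i, hi, h⟩ := hcon ρ
    simp only [Finset.mem_biUnion, Finset.mem_univ, Finset.mem_filter, true_and]
    refine ⟨i, hi, fun l hl hall => ?_⟩
    obtain ⟨β, hβ, hne⟩ := h l hl
    exact hne (hall β hβ)
  have h1 := (Finset.card_le_card hcover).trans Finset.card_biUnion_le
  have h2 : Fintype.card (B → Bool × Bool) * 64 ^ r ≤
      s * (Fintype.card (B → Bool × Bool) * 63 ^ r) := by
    rw [Finset.card_univ] at h1
    refine (Nat.mul_le_mul_right _ h1).trans ?_
    rw [Finset.sum_mul]
    refine (Finset.sum_le_sum fun i _ => hbad i).trans ?_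
    simp
  have hpos : 0 < Fintype.card (B → Bool × Bool) := Fintype.card_pos
  have h3 := Nat.mul_lt_mul_of_pos_left hs hpos
  have : s * (Fintype.card (B → Bool × Bool) * 63 ^ r) =
    Fintype.card (B → Bool × Bool) * (s * 63 ^ r) := by ring
  omega

end Counting

section Support

variable {V : Type} {m : ℕ}

/-- The cyclic predecessor. -/
def prev {M : ℕ} (κ : Fin M) : Fin M := ⟨(κ + (M - 1)) % M, Nat.mod_lt _ κ.pos⟩

lemma prev_next {M : ℕ} (κ : Fin M) : prev (next κ) = κ := by
  ext
  simp only [prev, next]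
  have := κ.isLt
  rcases Nat.lt_or_ge (κ + 1) M with h | h
  · rw [Nat.mod_eq_of_lt h, show (κ : ℕ) + 1 + (M - 1) = κ + M by omega, Nat.add_mod_right,
      Nat.mod_eq_of_lt this]
  · have h' : (κ : ℕ) + 1 = M := by omega
    rw [h', Nat.mod_self, Nat.zero_add, Nat.mod_eq_of_lt (by omega)]
    omega

lemma next_ne (κ : Fin (m * 3)) : next κ ≠ κ := by
  intro h
  have h := congrArg Fin.val h
  simp only [next] at h
  have := κ.isLt
  rcases Nat.lt_or_ge (κ + 1) (m * 3) with h' | h'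
  · rw [Nat.mod_eq_of_lt h'] at h
    omega
  · rw [show (κ : ℕ) + 1 = m * 3 by omega, Nat.mod_self] at h
    omega

/-- The blocks deciding the restriction of a literal. -/
def litSupport [DecidableEq V] (C : Fin m → Fin 3 → V × Bool) :
    Gad V m × Bool → Finset (V × Fin (m * 3))
  | (Sum.inl (v, κ, some _), _) => {(v, κ)}
  | (Sum.inl (v, κ, none), _) => {(v, κ), (v, next κ)}
  | (Sum.inr (k, _, _), _) =>
      {((C k 0).1, pos k 0), ((C k 1).1, pos k 1), ((C k 2).1, pos k 2)}

/-- An assignment to the blocks in the support of a literal making it true. -/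
def litWitness : Gad V m × Bool → V × Fin (m * 3) → Bool × Bool
  | (Sum.inl (_, _, some s), p), _ => (s, p)
  | (Sum.inl (_, κ, none), p), β => (true, if β.2 = κ then p else false)
  | (Sum.inr (_, D, j), p), β =>
      (true, if (finProdFinEquiv.symm β.2).2 = (if p then j + 1 else j) then
        !D (finProdFinEquiv.symm β.2).2 else D (finProdFinEquiv.symm β.2).2)

/-- The literals touching a given block. -/
def litTouch (g : (Option Bool ⊕ Unit ⊕ ((Fin 3 → Bool) × Fin 3)) × Bool)
    (β : V × Fin (m * 3)) : Gad V m × Bool :=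
  (match g.1 with
    | Sum.inl o => Sum.inl (β.1, β.2, o)
    | Sum.inr (Sum.inl _) => Sum.inl (β.1, prev β.2, none)
    | Sum.inr (Sum.inr (D, j)) => Sum.inr ((finProdFinEquiv.symm β.2).1, D, j), g.2)

variable [DecidableEq V] (C : Fin m → Fin 3 → V × Bool)

lemma card_litSupport (l : Gad V m × Bool) : (litSupport C l).card ≤ 3 := by
  rcases l with ⟨⟨v, κ, _ | s⟩ | ⟨k, D, j⟩, p⟩
  · exact Finset.card_le_two.trans (by norm_num)
  · simp [litSupport]
  · exact Finset.card_le_three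

lemma litSupport_nonempty (l : Gad V m × Bool) : (litSupport C l).Nonempty := by
  rcases l with ⟨⟨v, κ, _ | s⟩ | ⟨k, D, j⟩, p⟩ <;> simp [litSupport]

lemma exists_litTouch (l : Gad V m × Bool) (β : V × Fin (m * 3)) (hβ : β ∈ litSupport C l) :
    ∃ g, litTouch g β = l := by
  rcases l with ⟨⟨v, κ, _ | s⟩ | ⟨k, D, j⟩, p⟩
  · simp only [litSupport, Finset.mem_insert, Finset.mem_singleton] at hβ
    rcases hβ with rfl | rfl
    · exact ⟨(Sum.inl none, p), rfl⟩
    · exact ⟨(Sum.inr (Sum.inl ()), p), by simp [litTouch, prev_next]⟩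
  · simp only [litSupport, Finset.mem_singleton] at hβ
    subst hβ
    exact ⟨(Sum.inl (some s), p), rfl⟩
  · simp only [litSupport, Finset.mem_insert, Finset.mem_singleton] at hβ
    refine ⟨(Sum.inr (Sum.inr (D, j)), p), ?_⟩
    rcases hβ with rfl | rfl | rfl <;> simp [litTouch, pos]

lemma litImage_of_agree (l : Gad V m × Bool) (ρ : V × Fin (m * 3) → Bool × Bool)
    (h : ∀ β ∈ litSupport C l, ρ β = litWitness l β) :
    litImage (restrict C ρ) l = Sum.inl true := by
  rcases l with ⟨⟨v, κ, _ | s⟩ | ⟨k, D, j⟩, p⟩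
  · have h1 := h (v, κ) (by simp [litSupport])
    have h2 := h (v, next κ) (by simp [litSupport])
    simp only [litWitness, next_ne, if_false, if_true] at h1 h2
    simp [litImage, restrict, h1, h2]
  · have h1 := h (v, κ) (by simp [litSupport])
    simp only [litWitness] at h1
    simp [litImage, restrict, h1]
  · have h1 : ∀ i, ρ ((C k i).1, pos k i) = (true, if i = (if p then j + 1 else j) then !D i
        else D i) := by
      intro i
      rw [h ((C k i).1, pos k i) (by fin_cases i <;> simp [litSupport])]
      simp only [litWitness, pos, Equiv.symm_apply_apply]
    have h2 : ∀ i, broken C ρ k D i ↔ i = (if p then j + 1 else j) := by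
      intro i
      simp only [broken, h1, if_true]
      split_ifs <;> simp [*]
    simp only [litImage, restrict, h2]
    cases p
    · have : ∀ j' < j, j' ≠ j := fun j' h => h.ne
      simpa using this
    · fin_cases j <;> simp

end Support

/-- A restriction satisfying all wide clauses of a short list. -/
lemma exists_restriction {V : Type} [DecidableEq V] [Fintype V] {m : ℕ}
    (C : Fin m → Fin 3 → V × Bool) {s r : ℕ} (S : Fin s → Clause (Gad V m))
    (hs : s * 63 ^ r < 64 ^ r) :
    ∃ ρ : V × Fin (m * 3) → Bool × Bool, ∀ i, 168 * r ≤ (S i).card →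
      ∃ l ∈ S i, litImage (restrict C ρ) l = Sum.inl true := by
  obtain ⟨ρ, hρ⟩ := exists_assignment
    (γ := (Option Bool ⊕ Unit ⊕ ((Fin 3 → Bool) × Fin 3)) × Bool) (by decide)
    (litSupport C) (card_litSupport C) (litSupport_nonempty C) litTouch (exists_litTouch C)
    litWitness S hs
  refine ⟨ρ, fun i hi => ?_⟩
  obtain ⟨l, hl, h⟩ := hρ i hi
  exact ⟨l, hl, litImage_of_agree C l ρ h⟩

/-! ### The bracket formula and its lower bound -/

/-- Variables `(i, j, b)` stating that the partner of point `i` is `j` (if `b`),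
or is less than `j` (otherwise). -/
abbrev BVar (n : ℕ) : Type := Fin n × Fin (n + 1) × Bool

/-- The value of a variable when the partner is `k`. -/
def BVar.val {n : ℕ} (x : BVar n) (k : ℕ) : Bool :=
  if x.2.2 then decide (k = x.2.1) else decide (k < x.2.1)

/-- The points `i` and `k` are joined by a chord of `K`. -/
def Partner (K : Finset (ℕ × ℕ)) (i k : ℕ) : Prop := (i, k) ∈ K ∨ (k, i) ∈ K

/-- The literal is falsified by the chords in `K`. -/
def Fals {n : ℕ} (K : Finset (ℕ × ℕ)) (y : BVar n × Bool) : Prop :=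
  ∃ k, Partner K y.1.1 k ∧ y.1.val k ≠ y.2

/-- Three literals, not all of which can be falsified by a legal set of chords. -/
def SoundTriple (n : ℕ) (t : Fin 3 → BVar n × Bool) : Prop :=
  ∀ K, Legal n K → ∃ r, ¬ Fals K (t r)

open Classical in
/-- The number of clauses of the bracket formula. -/
noncomputable def bracketCount (n : ℕ) : ℕ := Fintype.card {t // SoundTriple n t}

open Classical in
/-- The bracket formula: all clauses with three literals that hold for every legal set of chords. -/
noncomputable def bracketClause (n : ℕ) (k : Fin (bracketCount n)) : Fin 3 → BVar n × Bool :=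
  ((Fintype.equivFin {t // SoundTriple n t}).symm k).1

lemma soundTriple_bracketClause (n : ℕ) (k : Fin (bracketCount n)) :
    SoundTriple n (bracketClause n k) := Subtype.prop _

lemma exists_bracketClause {n : ℕ} {t : Fin 3 → BVar n × Bool} (h : SoundTriple n t) :
    ∃ k, bracketClause n k = t := by
  classical
  exact ⟨Fintype.equivFin {t // SoundTriple n t} ⟨t, h⟩, by simp [bracketClause]⟩

lemma Partner.mono {K K' : Finset (ℕ × ℕ)} {i k : ℕ} (h : Partner K' i k) (hs : K' ⊆ K) :
    Partner K i k := h.imp (@hs _) (@hs _)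

lemma Fals.mono {n : ℕ} {K K' : Finset (ℕ × ℕ)} {y : BVar n × Bool} (h : Fals K' y)
    (hs : K' ⊆ K) : Fals K y := by
  obtain ⟨k, h1, h2⟩ := h
  exact ⟨k, h1.mono hs, h2⟩

lemma Legal.partner_unique {n : ℕ} {K : Finset (ℕ × ℕ)} (hK : Legal n K) {i k k' : ℕ}
    (h : Partner K i k) (h' : Partner K i k') : k = k' := by
  have key : ∀ z ∈ K, ∀ z' ∈ K, (z.1 = i ∨ z.2 = i) → (z'.1 = i ∨ z'.2 = i) → z = z' := by
    intro z hz z' hz' h1 h2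
    by_contra hne
    have := hK.compat z hz z' hz' hne
    have := hK.lt z hz
    have := hK.lt z' hz'
    unfold Compat at *
    omega
  rcases h with h | h <;> rcases h' with h' | h'
  · simpa using key _ h _ h' (by simp) (by simp)
  · have h1 := hK.lt _ h
    have h2 := hK.lt _ h'
    have := key _ h _ h' (by simp) (by simp)
    simp only [Prod.mk.injEq] at this h1 h2
    omega
  · have h1 := hK.lt _ h
    have h2 := hK.lt _ h'
    have := key _ h _ h' (by simp) (by simp)
    simp only [Prod.mk.injEq] at this h1 h2
    omega
  · simpa using key _ h _ h' (by simp) (by simp)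

section Walk

variable {n : ℕ} {X : Type}

/-- The literal is falsified by the substitution `σ` together with the chords in `K`. -/
def Falsified (σ : X → Bool ⊕ (BVar n × Bool)) (K : Finset (ℕ × ℕ)) (l : X × Bool) : Prop :=
  litImage σ l = Sum.inl false ∨ ∃ y, litImage σ l = Sum.inr y ∧ Fals K y

lemma Falsified.mono {σ : X → Bool ⊕ (BVar n × Bool)} {K K' : Finset (ℕ × ℕ)} {l : X × Bool}
    (h : Falsified σ K' l) (hs : K' ⊆ K) : Falsified σ K l :=
  h.imp_right fun ⟨y, h1, h2⟩ => ⟨y, h1, h2.mono hs⟩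

/-- A falsified clause with few literals that are not constant is falsified by few chords. -/
lemma exists_small_falsifier [DecidableEq X] {σ : X → Bool ⊕ (BVar n × Bool)}
    {K : Finset (ℕ × ℕ)} {w : ℕ} {c : Clause X} (h : ∀ l ∈ c, Falsified σ K l)
    (hw : (c.filter fun l => (litImage σ l).isRight).card ≤ w) :
    ∃ K' ⊆ K, K'.card ≤ w ∧ ∀ l ∈ c, Falsified σ K' l := by
  classical
  have hch : ∀ l ∈ c.filter fun l => (litImage σ l).isRight, ∃ z ∈ K, Falsified σ {z} l := by
    intro l hl
    rw [Finset.mem_filter] at hl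
    rcases h l hl.1 with h' | ⟨y, hy, k, hk, hv⟩
    · simp [h'] at hl
    · rcases hk with hk | hk
      · exact ⟨_, hk, Or.inr ⟨y, hy, k, Or.inl (by simp), hv⟩⟩
      · exact ⟨_, hk, Or.inr ⟨y, hy, k, Or.inr (by simp), hv⟩⟩
  choose! f hf using hch
  refine ⟨(c.filter fun l => (litImage σ l).isRight).image f, ?_, Finset.card_image_le.trans hw, ?_⟩
  · exact Finset.image_subset_iff.2 fun l hl => (hf l hl).1
  · intro l hl
    by_cases hr : (litImage σ l).isRight
    · have hl' : l ∈ c.filter fun l => (litImage σ l).isRight := Finset.mem_filter.2 ⟨hl, hr⟩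
      exact (hf l hl').2.mono (Finset.singleton_subset_iff.2 (Finset.mem_image_of_mem f hl'))
    · rcases h l hl with h' | ⟨y, hy, -⟩
      · exact Or.inl h'
      · simp [hy] at hr

/-- A surviving adversary refutes shallow refutations all of whose unsatisfied clauses have few
literals that are not constant. -/
lemma no_shallow_narrow_refutation [DecidableEq X] {F : Set (Clause X)} (R : Refutation X F)
    {σ : X → Bool ⊕ (BVar n × Bool)} {w d : ℕ}
    (hF : ∀ c ∈ F, ∀ K, Legal n K → ∃ l ∈ c, ¬ Falsified σ K l)
    (hw : ∀ i, (∃ l ∈ R.clause i, litImage σ l = Sum.inl true) ∨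
      ((R.clause i).filter fun l => (litImage σ l).isRight).card ≤ w)
    (hd : DepthLE R d) (hA : Alive n w d ∅) : False := by
  obtain ⟨h, hhd, hh⟩ := hd
  have key : ∀ (b : ℕ) (i : Fin R.size), (i : ℕ) = b → ∀ t K, h i ≤ t → Alive n w t K →
      (∀ l ∈ R.clause i, Falsified σ K l) → False := by
    intro b
    induction b using Nat.strong_induction_on with
    | _ b ih =>
      intro i hib t K ht hK hfal
      have hok := R.ok i
      rcases hp : R.prem i with _ | ⟨j, k, x⟩
      · rw [hp] at hok
        obtain ⟨l, hl, hnl⟩ := hF _ hok K hK.legal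
        exact hnl (hfal l hl)
      · rw [hp] at hok
        obtain ⟨hj, hk, hxj, hxk, heq⟩ := hok
        obtain ⟨hhj, hhk⟩ := hh i j k x hp
        have goj : ∀ t' K', h j ≤ t' → Alive n w t' K' → (∀ l ∈ R.clause i, Falsified σ K' l) →
            Falsified σ K' (x, true) → False := by
          intro t' K' ht' hK' hall hx
          refine ih j (by omega) j rfl t' K' ht' hK' fun l hl => ?_
          by_cases hlx : l = (x, true)
          · exact hlx ▸ hx
          · exact hall l (heq ▸ Finset.mem_union_left _ (Finset.mem_erase.2 ⟨hlx, hl⟩))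
        have gok : ∀ t' K', h k ≤ t' → Alive n w t' K' → (∀ l ∈ R.clause i, Falsified σ K' l) →
            Falsified σ K' (x, false) → False := by
          intro t' K' ht' hK' hall hx
          refine ih k (by omega) k rfl t' K' ht' hK' fun l hl => ?_
          by_cases hlx : l = (x, false)
          · exact hlx ▸ hx
          · exact hall l (heq ▸ Finset.mem_union_right _ (Finset.mem_erase.2 ⟨hlx, hl⟩))
        rcases hσ : σ x with b' | ⟨v, b'⟩
        · cases b'
          · exact goj t K (by omega) hK hfal (Or.inl (by simp [litImage, hσ]))
          · exact gok t K (by omega) hK hfal (Or.inl (by simp [litImage, hσ]))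
        · have hsmall : ((R.clause i).filter fun l => (litImage σ l).isRight).card ≤ w := by
            rcases hw i with ⟨l, hl, htrue⟩ | hsmall
            · rcases hfal l hl with h' | ⟨y, hy, -⟩
              · simp [htrue] at h'
              · simp [htrue] at hy
            · exact hsmall
          obtain ⟨K', hs, hc, hfal'⟩ := exists_small_falsifier hfal hsmall
          obtain ⟨t, rfl⟩ : ∃ t', t = t' + 1 := ⟨t - 1, by omega⟩
          obtain ⟨z, hz, hAz⟩ := hK.2 K' hs hc v.1 v.1.isLt
          obtain ⟨q, hq⟩ : ∃ q, Partner (insert z K') v.1 q := by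
            rcases hz with hz | hz
            · exact ⟨z.2, Or.inl (by simp [← hz])⟩
            · exact ⟨z.1, Or.inr (by simp [← hz])⟩
          have hfal'' : ∀ l ∈ R.clause i, Falsified σ (insert z K') l :=
            fun l hl => (hfal' l hl).mono (Finset.subset_insert _ _)
          by_cases hv : v.val q = (true ^^ b')
          · refine gok t _ (by omega) hAz hfal'' (Or.inr ⟨(v, false ^^ b'), by simp [litImage, hσ],
              q, hq, ?_⟩)
            simp [hv]
          · exact goj t _ (by omega) hAz hfal'' (Or.inr ⟨(v, true ^^ b'), by simp [litImage, hσ],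
              q, hq, hv⟩)
  refine key (R.size - 1) ⟨R.size - 1, Nat.sub_lt R.size_pos Nat.one_pos⟩ rfl d ∅ (hhd _) hA
    fun l hl => ?_
  rw [R.last_empty] at hl
  simp at hl

end Walk

/-- Renaming the variables of a clause. -/
def mapClause {X Y : Type} (e : X ↪ Y) (c : Clause X) : Clause Y :=
  c.map (e.prodMap (Function.Embedding.refl Bool))

lemma mem_mapClause {X Y : Type} {e : X ↪ Y} {c : Clause X} {l : Y × Bool} :
    l ∈ mapClause e c ↔ ∃ l' ∈ c, (e l'.1, l'.2) = l := by
  simp only [mapClause, Finset.mem_map]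
  rfl

/-- Shallow refutations of the lifted bracket formula are large. -/
lemma size_lower_bound {n : ℕ} {X : Type} [DecidableEq X]
    (e : Gad (BVar n) (bracketCount n) ↪ X) {F : Set (Clause X)}
    (hF : ∀ c ∈ F, ∃ c₀ ∈ lifted (bracketClause n), c = mapClause e c₀)
    (R : Refutation X F) {w r d : ℕ} (hr : 168 * r ≤ w + 1) (hd : DepthLE R d)
    (hA : Alive n w d ∅) : 64 ^ r ≤ R.size * 63 ^ r := by
  classical
  by_contra hcon
  push Not at hcon
  obtain ⟨ρ, hρ⟩ := exists_restriction (bracketClause n) (fun i => Finset.univ.filter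
    fun l : Gad (BVar n) (bracketCount n) × Bool => (e l.1, l.2) ∈ R.clause i) hcon
  let σ : X → Bool ⊕ (BVar n × Bool) :=
    Function.extend e (restrict (bracketClause n) ρ) fun _ => Sum.inl false
  have hσ : ∀ l : Gad (BVar n) (bracketCount n) × Bool,
      litImage σ (e l.1, l.2) = litImage (restrict (bracketClause n) ρ) l := by
    intro l
    simp only [litImage, σ, e.injective.extend_apply]
  refine no_shallow_narrow_refutation R (σ := σ) ?_ ?_ hd hA
  · intro c hc K hK
    obtain ⟨c₀, hc₀, rfl⟩ := hF c hc
    have hmem : ∀ l ∈ c₀, (e l.1, l.2) ∈ mapClause e c₀ := fun l hl => mem_mapClause.2 ⟨l, hl, rfl⟩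
    by_contra hall
    push Not at hall
    have hfal : ∀ l ∈ c₀, ∀ y, litImage (restrict (bracketClause n) ρ) l = Sum.inr y →
        Fals K y := by
      intro l hl y hy
      rcases hall _ (hmem l hl) with h | ⟨y', hy', h⟩
      · rw [hσ, hy] at h
        cases h
      · rw [hσ, hy] at hy'
        cases hy'
        exact h
    rcases restrict_lifted (bracketClause n) ρ hc₀ with ⟨l, hl, h⟩ | ⟨v, hv⟩ | ⟨k, hk⟩
    · rcases hall _ (hmem l hl) with h' | ⟨y, hy, -⟩
      · rw [hσ, h] at h'
        cases h'
      · rw [hσ, h] at hy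
        cases hy
    · obtain ⟨l, hl, h⟩ := hv false
      obtain ⟨l', hl', h'⟩ := hv true
      obtain ⟨q, hq, h1⟩ := hfal l hl _ h
      obtain ⟨q', hq', h2⟩ := hfal l' hl' _ h'
      cases hK.partner_unique hq hq'
      simp_all
    · obtain ⟨j, hj⟩ := soundTriple_bracketClause n k K hK
      obtain ⟨l, hl, h⟩ := hk j
      exact hj (hfal l hl _ h)
  · intro i
    by_cases hi : 168 * r ≤ (Finset.univ.filter
        fun l : Gad (BVar n) (bracketCount n) × Bool => (e l.1, l.2) ∈ R.clause i).card
    · obtain ⟨l, hl, h⟩ := hρ i hi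
      exact Or.inl ⟨_, (Finset.mem_filter.1 hl).2, (hσ l).trans h⟩
    · right
      have : ((R.clause i).filter fun l => (litImage σ l).isRight) ⊆ (Finset.univ.filter
          fun l : Gad (BVar n) (bracketCount n) × Bool => (e l.1, l.2) ∈ R.clause i).image
            fun l => (e l.1, l.2) := by
        intro l hl
        rw [Finset.mem_filter] at hl
        by_cases hx : ∃ g, e g = l.1
        · obtain ⟨g, hg⟩ := hx
          have hgl : (e g, l.2) = l := by rw [hg]
          exact Finset.mem_image.2 ⟨(g, l.2), by simpa [hgl] using hl.1, hgl⟩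
        · have h0 : σ l.1 = Sum.inl false := Function.extend_apply' _ _ _ hx
          simp [litImage, h0] at hl
      have := (Finset.card_le_card this).trans Finset.card_image_le
      omega

/-! ### Narrow refutations -/

section Narrow

variable {X : Type}

/-- The first `s` clauses of the sequence `f` form a resolution derivation from `F`. -/
def Derivation [DecidableEq X] (F : Set (Clause X)) (f : ℕ → Clause X) (s : ℕ) : Prop :=
  ∀ i < s, f i ∈ F ∨ ∃ j < i, ∃ k < i, ∃ x, (x, true) ∈ f j ∧ (x, false) ∈ f k ∧
    f i = (f j).erase (x, true) ∪ (f k).erase (x, false)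

lemma Derivation.exists_refutation [DecidableEq X] {F : Set (Clause X)} {f : ℕ → Clause X} {s : ℕ}
    (h : Derivation F f (s + 1)) (he : f s = ∅) : ∃ R : Refutation X F, R.size = s + 1 := by
  have hp : ∀ i : Fin (s + 1), ∃ p : Option (Fin (s + 1) × Fin (s + 1) × X),
      match p with
      | none => f i ∈ F
      | some (j, k, x) => j < i ∧ k < i ∧ (x, true) ∈ f j ∧ (x, false) ∈ f k ∧
          f i = (f j).erase (x, true) ∪ (f k).erase (x, false) := by
    intro i
    rcases h i i.isLt with h | ⟨j, hj, k, hk, x, h⟩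
    · exact ⟨none, h⟩
    · exact ⟨some (⟨j, hj.trans i.isLt⟩, ⟨k, hk.trans i.isLt⟩, x), hj, hk, h⟩
  choose p hp using hp
  refine ⟨⟨s + 1, s.succ_pos, fun i => f i, p, fun i => ?_, he⟩, rfl⟩
  have := hp i
  rcases h : p i with _ | ⟨j, k, x⟩ <;> rw [h] at this <;> exact this

lemma Derivation.snoc [DecidableEq X] {F : Set (Clause X)} {f : ℕ → Clause X} {s : ℕ}
    {c : Clause X} (h : Derivation F f s)
    (hc : c ∈ F ∨ ∃ j < s, ∃ k < s, ∃ x, (x, true) ∈ f j ∧ (x, false) ∈ f k ∧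
      c = (f j).erase (x, true) ∪ (f k).erase (x, false)) :
    Derivation F (Function.update f s c) (s + 1) := by
  have hlt : ∀ i < s, Function.update f s c i = f i := fun i hi =>
    Function.update_of_ne hi.ne _ _
  intro i hi
  rcases Nat.lt_succ_iff_lt_or_eq.1 hi with hi | rfl
  · rw [hlt i hi]
    refine (h i hi).imp_right fun ⟨j, hj, k, hk, x, h⟩ => ⟨j, hj, k, hk, x, ?_⟩
    rwa [hlt j (hj.trans hi), hlt k (hk.trans hi)]
  · rw [Function.update_self]
    refine hc.imp_right fun ⟨j, hj, k, hk, x, h⟩ => ⟨j, hj, k, hk, x, ?_⟩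
    rwa [hlt j hj, hlt k hk]

lemma card_narrow_clauses_le [Fintype X] [DecidableEq X] (W : ℕ) :
    (Finset.univ.filter fun c : Clause X => c.card ≤ W).card ≤ (2 * Fintype.card X + 1) ^ W := by
  have hsub : (Finset.univ.filter fun c : Clause X => c.card ≤ W) ⊆
      (Finset.univ : Finset (Fin W → Option (X × Bool))).image
        fun g => Finset.univ.filter fun l => ∃ i, g i = some l := by
    intro c hc
    rw [Finset.mem_filter] at hc
    refine Finset.mem_image.2 ⟨fun i => c.toList[(i : ℕ)]?, Finset.mem_univ _, ?_⟩
    ext l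
    simp only [Finset.mem_filter, Finset.mem_univ, true_and]
    rw [← Finset.mem_toList, List.mem_iff_getElem?]
    refine ⟨fun ⟨i, hi⟩ => ⟨i, hi⟩, fun ⟨i, hi⟩ => ?_⟩
    have := (List.getElem?_eq_some_iff.1 hi).1
    rw [Finset.length_toList] at this
    exact ⟨⟨i, by omega⟩, hi⟩
  refine (Finset.card_le_card hsub).trans (Finset.card_image_le.trans (le_of_eq ?_))
  rw [Finset.card_univ, Fintype.card_fun, Fintype.card_option, Fintype.card_prod, Fintype.card_bool,
    Fintype.card_fin, mul_comm]

/-- Either there is a short refutation, or the clauses of width at most `W` can be closed under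
resolution without producing the empty clause. -/
lemma exists_refutation_or_closed [Fintype X] [DecidableEq X] (F : Set (Clause X)) (W : ℕ) :
    (∃ R : Refutation X F, R.size ≤ (2 * Fintype.card X + 1) ^ W) ∨
    ∃ 𝒟 : Set (Clause X), ∅ ∉ 𝒟 ∧ (∀ c ∈ F, c.card ≤ W → c ∈ 𝒟) ∧
      ∀ c ∈ 𝒟, ∀ d ∈ 𝒟, ∀ x, (x, true) ∈ c → (x, false) ∈ d →
        (c.erase (x, true) ∪ d.erase (x, false)).card ≤ W →
        c.erase (x, true) ∪ d.erase (x, false) ∈ 𝒟 := by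
  let good (s : ℕ) (f : ℕ → Clause X) : Prop :=
    Derivation F f s ∧ Set.InjOn f (Set.Iio s) ∧ ∀ i < s, (f i).card ≤ W
  have hbound : ∀ s f, good s f → s ≤ (2 * Fintype.card X + 1) ^ W := by
    rintro s f ⟨-, hinj, hw⟩
    have := Finset.card_le_card_of_injOn (s := Finset.range s)
      (t := Finset.univ.filter fun c : Clause X => c.card ≤ W) f
      (fun i hi => by simpa using hw i (by simpa using hi)) (by simpa using hinj)
    rw [Finset.card_range] at this
    exact this.trans (card_narrow_clauses_le W)
  obtain ⟨s, f, hf, hmax⟩ : ∃ s f, good s f ∧ ¬ ∃ f', good (s + 1) f' := by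
    by_contra hcon
    push Not at hcon
    have hall : ∀ s, ∃ f, good s f := by
      intro s
      induction s with
      | zero => exact ⟨fun _ => ∅, by simp [Derivation], by simp, by simp⟩
      | succ s ih =>
        obtain ⟨f, hf⟩ := ih
        exact hcon s f hf
    obtain ⟨f, hf⟩ := hall ((2 * Fintype.card X + 1) ^ W + 1)
    exact absurd (hbound _ f hf) (by omega)
  by_cases he : ∃ i < s, f i = ∅
  · left
    obtain ⟨i, hi, he⟩ := he
    have hd : Derivation F f (i + 1) := fun j hj => hf.1 j (by omega)
    obtain ⟨R, hR⟩ := hd.exists_refutation he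
    exact ⟨R, by have := hbound s f hf; omega⟩
  · right
    have hclosed : ∀ c : Clause X, c.card ≤ W →
        (c ∈ F ∨ ∃ j < s, ∃ k < s, ∃ x, (x, true) ∈ f j ∧ (x, false) ∈ f k ∧
          c = (f j).erase (x, true) ∪ (f k).erase (x, false)) → c ∈ f '' Set.Iio s := by
      intro c hcW hc
      by_contra hnot
      have hlt : ∀ i < s, Function.update f s c i = f i := fun i hi =>
        Function.update_of_ne hi.ne _ _
      refine hmax ⟨Function.update f s c, hf.1.snoc hc, ?_, ?_⟩
      · intro i hi j hj hij
        rw [Set.mem_Iio] at hi hj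
        rcases Nat.lt_succ_iff_lt_or_eq.1 hi with hi | rfl <;>
          rcases Nat.lt_succ_iff_lt_or_eq.1 hj with hj | hj
        · rw [hlt i hi, hlt j hj] at hij
          exact hf.2.1 hi hj hij
        · subst hj
          rw [hlt i hi, Function.update_self] at hij
          exact absurd ⟨i, hi, hij⟩ hnot
        · rw [hlt j hj, Function.update_self] at hij
          exact absurd ⟨j, hj, hij.symm⟩ hnot
        · exact hj.symm
      · intro i hi
        rcases Nat.lt_succ_iff_lt_or_eq.1 hi with hi | rfl
        · rw [hlt i hi]
          exact hf.2.2 i hi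
        · rwa [Function.update_self]
    refine ⟨f '' Set.Iio s, ?_, fun c hc hW => hclosed c hW (Or.inl hc), ?_⟩
    · rintro ⟨i, hi, h⟩
      exact he ⟨i, hi, h⟩
    · rintro _ ⟨j, hj, rfl⟩ _ ⟨k, hk, rfl⟩ x h1 h2 hW
      exact hclosed _ hW (Or.inr ⟨j, hj, k, hk, x, h1, h2, rfl⟩)

/-- A family of sets of literals, thought of as falsified, on which a player with memory `W`
never gets caught falsifying a clause of `F`. -/
structure Strategy [DecidableEq X] (F : Set (Clause X)) (W : ℕ) (Ok : Clause X → Prop) : Prop where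
  empty : Ok ∅
  mono : ∀ {B B'}, Ok B → B' ⊆ B → Ok B'
  extend : ∀ {B}, Ok B → B.card + 1 ≤ W → ∀ x, ∃ b, Ok (insert (x, b) B)
  sound : ∀ {B}, Ok B → B.card ≤ W → ∀ c ∈ F, ¬ c ⊆ B

lemma exists_refutation_of_no_strategy [Fintype X] [DecidableEq X] {F : Set (Clause X)} {W : ℕ}
    (h : ∀ Ok, ¬ Strategy F W Ok) :
    ∃ R : Refutation X F, R.size ≤ (2 * Fintype.card X + 1) ^ W := by
  rcases exists_refutation_or_closed F W with h' | ⟨𝒟, h0, hF, hres⟩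
  · exact h'
  refine absurd ?_ (h fun B => ∀ c ∈ 𝒟, ¬ c ⊆ B)
  refine ⟨fun c hc hs => h0 (Finset.subset_empty.1 hs ▸ hc), fun hB hs c hc hc' =>
    hB c hc (hc'.trans hs), ?_, fun {B} hB hW c hc hs =>
    hB c (hF c hc ((Finset.card_le_card hs).trans hW)) hs⟩
  intro B hB hW x
  by_contra hcon
  push Not at hcon
  obtain ⟨c, hc, hcs⟩ := hcon true
  obtain ⟨d, hd, hds⟩ := hcon false
  have hxc : (x, true) ∈ c := by
    by_contra hx
    exact hB c hc ((Finset.subset_insert_iff_of_notMem hx).1 hcs)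
  have hxd : (x, false) ∈ d := by
    by_contra hx
    exact hB d hd ((Finset.subset_insert_iff_of_notMem hx).1 hds)
  have hsub : c.erase (x, true) ∪ d.erase (x, false) ⊆ B :=
    Finset.union_subset (Finset.subset_insert_iff.1 hcs) (Finset.subset_insert_iff.1 hds)
  exact hB _ (hres c hc d hd x hxc hxd
    ((Finset.card_le_card hsub).trans (by omega))) hsub

end Narrow

/-- Refutations can be transferred along a renaming of the variables. -/
lemma Refutation.exists_map {X Y : Type} [DecidableEq X] [DecidableEq Y] {F : Set (Clause X)}
    {G : Set (Clause Y)} (R : Refutation X F) (e : X ↪ Y) (h : ∀ c ∈ F, mapClause e c ∈ G) :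
    ∃ R' : Refutation Y G, R'.size = R.size := by
  refine ⟨⟨R.size, R.size_pos, fun i => mapClause e (R.clause i),
    fun i => (R.prem i).map fun p => (p.1, p.2.1, e p.2.2), ?_, ?_⟩, rfl⟩
  · intro i
    have hok := R.ok i
    rcases hp : R.prem i with _ | ⟨j, k, x⟩
    · rw [hp] at hok
      exact h _ hok
    · rw [hp] at hok
      obtain ⟨hj, hk, hxj, hxk, heq⟩ := hok
      refine ⟨hj, hk, mem_mapClause.2 ⟨_, hxj, rfl⟩, mem_mapClause.2 ⟨_, hxk, rfl⟩, ?_⟩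
      rw [heq]
      simp only [mapClause, Finset.map_union, Finset.map_erase]
      rfl
  · simp [R.last_empty, mapClause]

lemma Refutation.unsat {X : Type} [DecidableEq X] {F : Set (Clause X)} (R : Refutation X F) :
    Unsat F := by
  intro α
  by_contra hcon
  push Not at hcon
  have key : ∀ (b : ℕ) (i : Fin R.size), (i : ℕ) = b → SatC α (R.clause i) := by
    intro b
    induction b using Nat.strong_induction_on with
    | _ b ih =>
      intro i hib
      have hok := R.ok i
      rcases hp : R.prem i with _ | ⟨j, k, x⟩
      · rw [hp] at hok
        exact hcon _ hok
      · rw [hp] at hok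
        obtain ⟨hj, hk, -, -, heq⟩ := hok
        obtain ⟨l, hl, hαl⟩ := ih j (by omega) j rfl
        obtain ⟨l', hl', hαl'⟩ := ih k (by omega) k rfl
        rw [heq]
        by_cases h1 : l = (x, true)
        · refine ⟨l', Finset.mem_union_right _ (Finset.mem_erase.2 ⟨?_, hl'⟩), hαl'⟩
          rintro rfl
          subst h1
          simp_all
        · exact ⟨l, Finset.mem_union_left _ (Finset.mem_erase.2 ⟨h1, hl⟩), hαl⟩
  obtain ⟨l, hl, -⟩ := key (R.size - 1) ⟨R.size - 1, Nat.sub_lt R.size_pos Nat.one_pos⟩ rfl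
  rw [R.last_empty] at hl
  simp at hl

/-! ### From the lifted formula to the bracket formula -/

section Shares

variable {V : Type} {m : ℕ} [DecidableEq V]

/-- The falsified literals on the shares which express that the literal `l` is falsified. -/
def shares (κ : Fin (m * 3)) (D : Bool) (l : V × Bool) : Clause (Gad V m) :=
  {(Sum.inl (l.1, κ, some true), !D), (Sum.inl (l.1, κ, some false), D ^^ l.2)}

lemma card_shares_le (κ : Fin (m * 3)) (D : Bool) (l : V × Bool) : (shares κ D l).card ≤ 2 :=
  Finset.card_le_two

variable [Fintype V] {C : Fin m → Fin 3 → V × Bool} {W : ℕ} {Ok : Clause (Gad V m) → Prop}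

lemma Strategy.move_next (h : Strategy (lifted C : Set (Clause (Gad V m))) W Ok)
    {κ : Fin (m * 3)} {D : Bool} {l : V × Bool} {B : Clause (Gad V m)} (hB : Ok (shares κ D l ∪ B))
    (hW : B.card + 5 ≤ W) : ∃ D', Ok (shares (next κ) D' l ∪ B) := by
  have hc := (Finset.card_union_le (shares κ D l) B).trans
    (Nat.add_le_add_right (card_shares_le κ D l) _)
  obtain ⟨c, h1⟩ := h.extend hB (by omega) (Sum.inl (l.1, κ, none))
  have hc1 := Finset.card_insert_le (Sum.inl (l.1, κ, none), c) (shares κ D l ∪ B)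
  obtain ⟨x, h2⟩ := h.extend h1 (by omega) (Sum.inl (l.1, next κ, some true))
  have hc2 := Finset.card_insert_le (Sum.inl (l.1, next κ, some true), x)
    (insert (Sum.inl (l.1, κ, none), c) (shares κ D l ∪ B))
  obtain ⟨y, h3⟩ := h.extend h2 (by omega) (Sum.inl (l.1, next κ, some false))
  have hc3 := Finset.card_insert_le (Sum.inl (l.1, next κ, some false), y)
    (insert (Sum.inl (l.1, next κ, some true), x)
      (insert (Sum.inl (l.1, κ, none), c) (shares κ D l ∪ B)))
  have e1 := h.sound h3 (by omega) _ (link_mem_lifted C l.1 κ true D (!x))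
  have e2 := h.sound h3 (by omega) _ (link_mem_lifted C l.1 κ false (!(D ^^ l.2)) (!y))
  have hx : c ≠ (D ^^ !x) := by
    rintro rfl
    refine e1 fun a ha => ?_
    simp only [linkClause, Finset.mem_insert, Finset.mem_singleton, Bool.not_not] at ha
    rcases ha with rfl | rfl | rfl <;> simp [shares]
  have hy : c ≠ (!(D ^^ l.2) ^^ !y) := by
    rintro rfl
    refine e2 fun a ha => ?_
    simp only [linkClause, Finset.mem_insert, Finset.mem_singleton, Bool.not_not] at ha
    rcases ha with rfl | rfl | rfl <;> simp [shares]
  refine ⟨!x, h.mono h3 fun a ha => ?_⟩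
  have hxy : (!x ^^ l.2) = y :=
    (by decide : ∀ c D x y b : Bool, c ≠ (D ^^ !x) → c ≠ (!(D ^^ b) ^^ !y) → (!x ^^ b) = y)
      c D x y l.2 hx hy
  simp only [shares, Finset.mem_union, Finset.mem_insert, Finset.mem_singleton, Bool.not_not,
    hxy] at ha
  rcases ha with (rfl | rfl) | ha
  · simp
  · simp
  · simp [ha]

lemma Strategy.move (h : Strategy (lifted C : Set (Clause (Gad V m))) W Ok)
    {κ : Fin (m * 3)} {D : Bool} {l : V × Bool} {B : Clause (Gad V m)} (hB : Ok (shares κ D l ∪ B))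
    (hW : B.card + 5 ≤ W) (κ' : Fin (m * 3)) : ∃ D', Ok (shares κ' D' l ∪ B) := by
  have key : ∀ t : ℕ, ∀ κ' : Fin (m * 3), (κ' : ℕ) = (κ + t) % (m * 3) →
      ∃ D', Ok (shares κ' D' l ∪ B) := by
    intro t
    induction t with
    | zero =>
      intro κ' h'
      obtain rfl : κ' = κ := Fin.ext (by rw [h', add_zero, Nat.mod_eq_of_lt κ.isLt])
      exact ⟨D, hB⟩
    | succ t ih =>
      intro κ' h'
      obtain ⟨D', hD'⟩ := ih ⟨(κ + t) % (m * 3), Nat.mod_lt _ κ.pos⟩ rfl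
      obtain rfl : κ' = next ⟨(κ + t) % (m * 3), Nat.mod_lt _ κ.pos⟩ :=
        Fin.ext (by simp [next, h', add_assoc])
      exact h.move_next hD' hW
  refine key (κ' + (m * 3 - κ)) κ' ?_
  have := κ.isLt
  rw [show (κ : ℕ) + (κ' + (m * 3 - κ)) = κ' + m * 3 by omega, Nat.add_mod_right,
    Nat.mod_eq_of_lt κ'.isLt]

lemma Strategy.extend_false (h : Strategy (lifted C : Set (Clause (Gad V m))) W Ok) {k : Fin m}
    {D : Fin 3 → Bool} {j : Fin 3} {B : Clause (Gad V m)} (hB : Ok B) (hW : B.card + 1 ≤ W)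
    (hs : shares (pos k j) (D j) (C k j) ⊆ B) : Ok (insert (Sum.inr (k, D, j), false) B) := by
  obtain ⟨b, hb⟩ := h.extend hB hW (Sum.inr (k, D, j))
  cases b
  · exact hb
  · exfalso
    have hc := Finset.card_insert_le (Sum.inr (k, D, j), true) B
    refine h.sound hb (by omega) _ (pattern_mem_lifted C k D j) fun a ha => ?_
    simp only [patternClause, Finset.mem_insert, Finset.mem_singleton] at ha
    rcases ha with rfl | rfl | rfl
    · exact Finset.mem_insert_of_mem (hs (by simp [shares]))
    · exact Finset.mem_insert_of_mem (hs (by simp [shares]))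
    · exact Finset.mem_insert_self _ _

lemma Strategy.not_falsified (h : Strategy (lifted C : Set (Clause (Gad V m))) W Ok)
    {B : Clause (Gad V m)} (hB : Ok B) (hW : B.card + 9 ≤ W) (k : Fin m) (κ : Fin (m * 3))
    (hs : ∀ j, ∃ D, shares κ D (C k j) ⊆ B) : False := by
  have step : ∀ (j : Fin 3) (B' : Clause (Gad V m)), Ok B' → B ⊆ B' → B'.card + 5 ≤ W →
      ∃ D, Ok (shares (pos k j) D (C k j) ∪ B') := by
    intro j B' hB' hsub hW'
    obtain ⟨D, hD⟩ := hs j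
    exact h.move (κ := κ) (D := D) (by rwa [Finset.union_eq_right.2 (hD.trans hsub)]) hW' _
  have hcard : ∀ (j : Fin 3) D B', (shares (pos k j) D (C k j) ∪ B').card ≤ B'.card + 2 := by
    intro j D B'
    have := Finset.card_union_le (shares (pos k j) D (C k j)) B'
    have := card_shares_le (pos k j) D (C k j)
    omega
  obtain ⟨D0, h0⟩ := step 0 B hB subset_rfl (by omega)
  have c0 := hcard 0 D0 B
  obtain ⟨D1, h1⟩ := step 1 _ h0 Finset.subset_union_right (by omega)
  have c1 := hcard 1 D1 (shares (pos k 0) D0 (C k 0) ∪ B)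
  obtain ⟨D2, h2⟩ := step 2 _ h1 (Finset.subset_union_right.trans Finset.subset_union_right)
    (by omega)
  have c2 := hcard 2 D2 (shares (pos k 1) D1 (C k 1) ∪ (shares (pos k 0) D0 (C k 0) ∪ B))
  set B3 := shares (pos k 2) D2 (C k 2) ∪
    (shares (pos k 1) D1 (C k 1) ∪ (shares (pos k 0) D0 (C k 0) ∪ B))
  have s0 : shares (pos k 0) D0 (C k 0) ⊆ B3 :=
    Finset.subset_union_left.trans (Finset.subset_union_right.trans Finset.subset_union_right)
  have s1 : shares (pos k 1) D1 (C k 1) ⊆ B3 :=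
    Finset.subset_union_left.trans Finset.subset_union_right
  have s2 : shares (pos k 2) D2 (C k 2) ⊆ B3 := Finset.subset_union_left
  have h3 := h.extend_false (k := k) (D := ![D0, D1, D2]) (j := 0) h2 (by omega) s0
  have c3 := Finset.card_insert_le (Sum.inr (k, ![D0, D1, D2], 0), false) B3
  have h4 := h.extend_false (k := k) (D := ![D0, D1, D2]) (j := 1) h3 (by omega)
    (s1.trans (Finset.subset_insert _ _))
  have c4 := Finset.card_insert_le (Sum.inr (k, ![D0, D1, D2], 1), false)
    (insert (Sum.inr (k, ![D0, D1, D2], 0), false) B3)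
  have h5 := h.extend_false (k := k) (D := ![D0, D1, D2]) (j := 2) h4 (by omega)
    (s2.trans ((Finset.subset_insert _ _).trans (Finset.subset_insert _ _)))
  have c5 := Finset.card_insert_le (Sum.inr (k, ![D0, D1, D2], 2), false)
    (insert (Sum.inr (k, ![D0, D1, D2], 1), false)
      (insert (Sum.inr (k, ![D0, D1, D2], 0), false) B3))
  refine h.sound h5 (by omega) _ (cap_mem_lifted C k ![D0, D1, D2]) fun a ha => ?_
  simp only [capClause, Finset.mem_insert, Finset.mem_singleton] at ha
  rcases ha with rfl | rfl | rfl <;> simp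

/-- A strategy for the lifted formula gives one for the original formula. -/
lemma Strategy.unlift {w : ℕ}
    (h : Strategy (lifted C : Set (Clause (Gad V m))) (2 * w + 9) Ok) (κ : Fin (m * 3)) :
    Strategy {c : Clause V | ∃ k, c = Finset.univ.image (C k)} w
      fun β => ∃ D : V × Bool → Bool, Ok (β.biUnion fun l => shares κ (D l) l) := by
  have hcard : ∀ (β : Clause V) (D : V × Bool → Bool),
      (β.biUnion fun l => shares κ (D l) l).card ≤ 2 * β.card := fun β D =>
    (Finset.card_biUnion_le_card_mul _ _ 2 fun l _ => card_shares_le κ (D l) l).trans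
      (mul_comm _ _).le
  refine ⟨⟨fun _ => true, by simpa using h.empty⟩, ?_, ?_, ?_⟩
  · rintro B B' ⟨D, hD⟩ hs
    exact ⟨D, h.mono hD (Finset.biUnion_subset_biUnion_of_subset_left _ hs)⟩
  · rintro β ⟨D, hD⟩ hβ v
    have c0 := hcard β D
    obtain ⟨x, h1⟩ := h.extend hD (by omega) (Sum.inl (v, κ, some true))
    have c1 := Finset.card_insert_le (Sum.inl (v, κ, some true), x)
      (β.biUnion fun l => shares κ (D l) l)
    obtain ⟨y, h2⟩ := h.extend h1 (by omega) (Sum.inl (v, κ, some false))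
    refine ⟨!x ^^ y, ?_⟩
    by_cases hmem : (v, !x ^^ y) ∈ β
    · exact ⟨D, by rwa [Finset.insert_eq_of_mem hmem]⟩
    refine ⟨Function.update D (v, !x ^^ y) (!x), h.mono h2 fun a ha => ?_⟩
    rw [Finset.biUnion_insert, Finset.mem_union, Function.update_self] at ha
    rcases ha with ha | ha
    · simp only [shares, Finset.mem_insert, Finset.mem_singleton, Bool.not_not] at ha
      rcases ha with rfl | rfl
      · simp
      · have : (!x ^^ (!x ^^ y)) = y := by cases x <;> cases y <;> rfl
        rw [this]
        exact Finset.mem_insert_self _ _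
    · refine Finset.mem_insert_of_mem (Finset.mem_insert_of_mem ?_)
      obtain ⟨l, hl, ha⟩ := Finset.mem_biUnion.1 ha
      have hne : l ≠ (v, !x ^^ y) := fun hlv => hmem (hlv ▸ hl)
      rw [Function.update_of_ne hne] at ha
      exact Finset.mem_biUnion.2 ⟨l, hl, ha⟩
  · rintro β ⟨D, hD⟩ hβ _ ⟨k, rfl⟩ hs
    have c0 := hcard β D
    refine h.not_falsified hD (by omega) k κ fun j => ⟨D (C k j), ?_⟩
    exact Finset.subset_biUnion_of_mem (fun l => shares κ (D l) l)
      (hs (Finset.mem_image_of_mem _ (Finset.mem_univ j)))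

end Shares

/-! ### Binary search for a violated bracket -/

section Search

variable {n w : ℕ} {Ok : Clause (BVar n) → Prop}

/-- The bracket formula as a set of clauses. -/
def bracketFormula (n : ℕ) : Set (Clause (BVar n)) :=
  {c | ∃ k, c = Finset.univ.image (bracketClause n k)}

/-- The literal falsified when the partner of `i` is `j`. -/
def joined (i j : Fin n) : BVar n × Bool := ((i, j.castSucc, true), false)

lemma fals_joined {K : Finset (ℕ × ℕ)} {i j : Fin n} (h : Fals K (joined i j)) :
    Partner K i j := by
  obtain ⟨k, hk, hv⟩ := h
  obtain rfl : k = j := by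
    by_contra hne
    exact hv (by simp [joined, BVar.val, hne])
  exact hk

/-- The literals falsified when all pairs in `K` are joined. -/
def joinedSet (K : Finset (Fin n × Fin n)) : Clause (BVar n) :=
  K.image (fun z => joined z.1 z.2) ∪ K.image fun z => joined z.2 z.1

lemma card_joinedSet_le (K : Finset (Fin n × Fin n)) : (joinedSet K).card ≤ 2 * K.card := by
  have h1 := Finset.card_union_le (K.image fun z => joined z.1 z.2) (K.image fun z => joined z.2 z.1)
  have h2 := Finset.card_image_le (s := K) (f := fun z => joined z.1 z.2)
  have h3 := Finset.card_image_le (s := K) (f := fun z => joined z.2 z.1)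
  unfold joinedSet
  omega

lemma joinedSet_mono {K K' : Finset (Fin n × Fin n)} (h : K' ⊆ K) : joinedSet K' ⊆ joinedSet K :=
  Finset.union_subset_union (Finset.image_subset_image h) (Finset.image_subset_image h)

lemma joined_mem_joinedSet {K : Finset (Fin n × Fin n)} {z : Fin n × Fin n} (h : z ∈ K) :
    joined z.1 z.2 ∈ joinedSet K :=
  Finset.mem_union_left _ (Finset.mem_image.2 ⟨z, h, rfl⟩)

lemma Strategy.not_sound (h : Strategy (bracketFormula n) w Ok) {β : Clause (BVar n)} (hβ : Ok β)
    (hw : β.card ≤ w) {t : Fin 3 → BVar n × Bool} (ht : ∀ r, t r ∈ β) : ¬ SoundTriple n t := by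
  intro hs
  obtain ⟨k, hk⟩ := exists_bracketClause hs
  refine h.sound hβ hw _ ⟨k, rfl⟩ ?_
  rw [hk]
  exact Finset.image_subset_iff.2 fun r _ => ht r

/-- Any three falsified literals are falsified by some legal configuration. -/
lemma Strategy.exists_legal (h : Strategy (bracketFormula n) w Ok) {β : Clause (BVar n)}
    (hβ : Ok β) (hw : β.card ≤ w) {x y z : BVar n × Bool} (hx : x ∈ β) (hy : y ∈ β) (hz : z ∈ β) :
    ∃ K, Legal n K ∧ Fals K x ∧ Fals K y ∧ Fals K z := by
  have := h.not_sound hβ hw (t := ![x, y, z]) (by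
    intro r
    fin_cases r <;> assumption)
  unfold SoundTriple at this
  push Not at this
  obtain ⟨K, hK, hr⟩ := this
  exact ⟨K, hK, hr 0, hr 1, hr 2⟩

/-- The strategy accepts the chords in `K`. -/
def Accepts (Ok : Clause (BVar n) → Prop) (K : Finset (Fin n × Fin n)) : Prop :=
  (∀ z ∈ K, z.1 < z.2) ∧ Ok (joinedSet K)

lemma Strategy.accepts_mono (h : Strategy (bracketFormula n) w Ok) {K K' : Finset (Fin n × Fin n)}
    (hK : Accepts Ok K) (hs : K' ⊆ K) : Accepts Ok K' :=
  ⟨fun z hz => hK.1 z (hs hz), h.mono hK.2 (joinedSet_mono hs)⟩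

lemma Legal.mem_of_partner {K : Finset (ℕ × ℕ)} (hK : Legal n K) {i j : ℕ} (h : Partner K i j)
    (hij : i < j) : (i, j) ∈ K :=
  h.resolve_right fun h' => absurd (hK.lt _ h') (by simpa using hij.le)

lemma Strategy.compat (h : Strategy (bracketFormula n) w Ok) {K : Finset (Fin n × Fin n)}
    (hK : Accepts Ok K) (hw : 2 * K.card ≤ w) {z z' : Fin n × Fin n} (hz : z ∈ K) (hz' : z' ∈ K)
    (hne : z ≠ z') : Compat (z.1, z.2) (z'.1, z'.2) := by
  obtain ⟨L, hL, h1, h2, -⟩ := h.exists_legal hK.2 ((card_joinedSet_le K).trans hw)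
    (joined_mem_joinedSet hz) (joined_mem_joinedSet hz') (joined_mem_joinedSet hz)
  refine hL.compat _ (hL.mem_of_partner (fals_joined h1) (hK.1 z hz)) _
    (hL.mem_of_partner (fals_joined h2) (hK.1 z' hz')) fun heq => hne ?_
  simp only [Prod.mk.injEq] at heq
  exact Prod.ext (Fin.ext heq.1) (Fin.ext heq.2)

lemma Strategy.parity (h : Strategy (bracketFormula n) w Ok) {K : Finset (Fin n × Fin n)}
    (hK : Accepts Ok K) (hw : 2 * K.card ≤ w) {z : Fin n × Fin n} (hz : z ∈ K) :
    ((z.1 : ℕ) + z.2) % 2 = 1 := by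
  obtain ⟨L, hL, h1, -⟩ := h.exists_legal hK.2 ((card_joinedSet_le K).trans hw)
    (joined_mem_joinedSet hz) (joined_mem_joinedSet hz) (joined_mem_joinedSet hz)
  exact hL.parity _ (hL.mem_of_partner (fals_joined h1) (hK.1 z hz))

/-- The partner of a point can be found with three further memory cells. -/
lemma Strategy.exists_joined (h : Strategy (bracketFormula n) w Ok) {β : Clause (BVar n)}
    (hβ : Ok β) (hw : β.card + 3 ≤ w) (i : Fin n) : ∃ j, Ok (insert (joined i j) β) := by
  have card2 : ∀ x : BVar n × Bool, (insert x β).card ≤ β.card + 1 := fun x =>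
    Finset.card_insert_le _ _
  have card3 : ∀ x y : BVar n × Bool, (insert x (insert y β)).card ≤ β.card + 2 := fun x y =>
    (Finset.card_insert_le _ _).trans (Nat.add_le_add_right (card2 y) 1)
  have card4 : ∀ x y z : BVar n × Bool, (insert x (insert y (insert z β))).card ≤ β.card + 3 :=
    fun x y z => (Finset.card_insert_le _ _).trans (Nat.add_le_add_right (card3 y z) 1)
  by_contra hcon
  push Not at hcon
  have key : ∀ j : ℕ, ∀ hj : j < n + 1, Ok (insert ((i, ⟨j, hj⟩, false), true) β) := by
    intro j
    induction j with
    | zero =>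
      intro hj
      obtain ⟨b, hb⟩ := h.extend hβ (by omega) (i, ⟨0, hj⟩, false)
      cases b
      · have hm := Finset.mem_insert_self ((i, (⟨0, hj⟩ : Fin (n + 1)), false), false) β
        obtain ⟨L, -, ⟨k, -, hk⟩, -⟩ := h.exists_legal hb ((card2 _).trans (by omega)) hm hm hm
        simp [BVar.val] at hk
      · exact hb
    | succ j ih =>
      intro hj
      have hj' : j < n + 1 := by omega
      have h1 := ih hj'
      obtain ⟨b, hb⟩ := h.extend h1 (by have := card2 ((i, ⟨j, hj'⟩, false), true); omega)
        (i, ⟨j + 1, hj⟩, false)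
      cases b
      · exfalso
        obtain ⟨b, hb'⟩ := h.extend hb (by
          have := card3 ((i, ⟨j + 1, hj⟩, false), false) ((i, ⟨j, hj'⟩, false), true)
          omega) (i, ⟨j, hj'⟩, true)
        cases b
        · refine hcon ⟨j, by omega⟩ (h.mono hb' ?_)
          exact Finset.insert_subset_insert _
            ((Finset.subset_insert _ _).trans (Finset.subset_insert _ _))
        · obtain ⟨L, hL, ⟨k, hk, e1⟩, ⟨k', hk', e2⟩, ⟨k'', hk'', e3⟩⟩ := h.exists_legal hb'
            ((card4 _ _ _).trans hw) (x := ((i, ⟨j, hj'⟩, true), true))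
            (y := ((i, ⟨j + 1, hj⟩, false), false)) (z := ((i, ⟨j, hj'⟩, false), true))
            (by simp) (by simp) (by simp)
          obtain rfl := hL.partner_unique hk hk'
          obtain rfl := hL.partner_unique hk hk''
          simp [BVar.val] at e1 e2 e3
          omega
      · exact h.mono hb (Finset.insert_subset_insert _ (Finset.subset_insert _ _))
  have hn := key n (by omega)
  have hm := Finset.mem_insert_self ((i, (⟨n, by omega⟩ : Fin (n + 1)), false), true) β
  obtain ⟨L, hL, ⟨k, hk, e1⟩, -⟩ := h.exists_legal hn ((card2 _).trans (by omega)) hm hm hm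
  have : k < n := by
    rcases hk with hk | hk
    · exact hL.bound _ hk
    · exact (hL.lt _ hk).trans (hL.bound _ hk)
  simp [BVar.val] at e1
  omega

lemma Strategy.exists_accepts (h : Strategy (bracketFormula n) w Ok) {K : Finset (Fin n × Fin n)}
    (hK : Accepts Ok K) (hw : 2 * K.card + 3 ≤ w) (i : Fin n) :
    ∃ z, (z.1 = i ∨ z.2 = i) ∧ Accepts Ok (insert z K) := by
  have hc := card_joinedSet_le K
  obtain ⟨j, hj⟩ := h.exists_joined hK.2 (by omega) i
  have hc1 := Finset.card_insert_le (joined i j) (joinedSet K)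
  obtain ⟨b, hb⟩ := h.extend hj (by omega) (j, i.castSucc, true)
  have hc2 := Finset.card_insert_le ((j, i.castSucc, true), b) (insert (joined i j) (joinedSet K))
  obtain ⟨L, hL, h1, ⟨k, hk, h2⟩, -⟩ := h.exists_legal hb (by omega) (x := joined i j)
    (y := ((j, i.castSucc, true), b)) (z := joined i j) (by simp) (by simp) (by simp)
  have h1 := fals_joined h1
  obtain rfl := hL.partner_unique h1.symm hk
  have hne : i ≠ j := by
    rintro rfl
    rcases h1 with h1 | h1 <;> exact absurd (hL.lt _ h1) (by simp)
  cases b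
  swap
  · simp [BVar.val] at h2
  rcases lt_or_gt_of_ne hne with hlt | hlt
  · refine ⟨(i, j), Or.inl rfl, ?_, h.mono hb ?_⟩
    · intro z hz
      rcases Finset.mem_insert.1 hz with rfl | hz
      exacts [hlt, hK.1 z hz]
    · intro l hl
      simp only [joinedSet, Finset.image_insert, Finset.mem_union, Finset.mem_insert] at hl ⊢
      simp only [joined] at hl ⊢
      tauto
  · refine ⟨(j, i), Or.inr rfl, ?_, h.mono hb ?_⟩
    · intro z hz
      rcases Finset.mem_insert.1 hz with rfl | hz
      exacts [hlt, hK.1 z hz]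
    · intro l hl
      simp only [joinedSet, Finset.image_insert, Finset.mem_union, Finset.mem_insert] at hl ⊢
      simp only [joined] at hl ⊢
      tauto

/-- The chord has exactly one endpoint in the interval `[lo, hi)`. -/
def Leaves (z : Fin n × Fin n) (lo hi : ℕ) : Prop :=
  ((z.1 : ℕ) < lo ∧ lo ≤ z.2 ∧ (z.2 : ℕ) < hi) ∨ (lo ≤ z.1 ∧ (z.1 : ℕ) < hi ∧ hi ≤ z.2)

/-- A chord leaving an interval of odd length can be found by binary search. -/
lemma Strategy.exists_leaves (h : Strategy (bracketFormula n) w Ok) (k : ℕ) :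
    ∀ (K : Finset (Fin n × Fin n)) (lo hi : ℕ), Accepts Ok K → 2 * (K.card + k) + 3 ≤ w →
      (hi - lo) % 2 = 1 → hi ≤ n → hi - lo < 2 ^ k →
      ∃ z, Leaves z lo hi ∧ Accepts Ok (insert z K) := by
  induction k with
  | zero => intro K lo hi _ _ hodd _ hlt; omega
  | succ k ih =>
    intro K lo hi hK hw hodd hhi hlt
    rw [pow_succ] at hlt
    have hcard : ∀ z, (insert z K).card ≤ K.card + 1 := fun z => Finset.card_insert_le _ _
    have enclose : ∀ s : ℕ, ∀ e : Fin n × Fin n, hi - lo - (e.2 - e.1) = s →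
        Accepts Ok (insert e K) → lo ≤ e.1 → (e.1 : ℕ) ≤ lo + (hi - lo) / 2 →
        lo + (hi - lo) / 2 ≤ e.2 → (e.2 : ℕ) < hi → ∃ z, Leaves z lo hi ∧ Accepts Ok (insert z K) := by
      intro s
      induction s using Nat.strong_induction_on with
      | _ s ihs =>
        intro e hs he h1 h2 h3 h4
        have hce := hcard e
        have hpar := h.parity he (by omega) (Finset.mem_insert_self e K)
        have finish : ∀ z, Accepts Ok (insert z (insert e K)) → z ≠ e →
            (Leaves z lo hi ∨ lo ≤ z.1 ∧ (z.2 : ℕ) < hi ∧ z.1 < z.2 ∧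
              (Compat (z.1, z.2) (e.1, e.2) → (z.1 : ℕ) < e.1 ∧ (e.2 : ℕ) < z.2)) →
            ∃ z, Leaves z lo hi ∧ Accepts Ok (insert z K) := by
          intro z hz hne hcase
          have hzK : Accepts Ok (insert z K) :=
            h.accepts_mono hz (Finset.insert_subset_insert _ (Finset.subset_insert _ _))
          rcases hcase with hl | ⟨a1, a2, a3, a4⟩
          · exact ⟨z, hl, hzK⟩
          have hcz := Finset.card_insert_le z (insert e K)
          have hcomp := a4 (h.compat hz (by omega) (by simp) (by simp) hne)
          refine ihs _ ?_ z rfl hzK a1 ?_ ?_ a2 <;> omega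
        have hle := he.1 e (Finset.mem_insert_self e K)
        rcases Nat.mod_two_eq_zero_or_one (e.1 - lo) with hp | hp
        · obtain ⟨z, hz, hzA⟩ := ih (insert e K) (e.2 + 1) hi he (by omega) (by omega) hhi (by omega)
          have hlz := hzA.1 z (Finset.mem_insert_self _ _)
          refine finish z hzA ?_ ?_
          · rintro rfl
            unfold Leaves at hz
            omega
          · unfold Leaves Compat at *
            simp only at *
            omega
        · obtain ⟨z, hz, hzA⟩ := ih (insert e K) lo e.1 he (by omega) (by omega) (by omega) (by omega)
          have hlz := hzA.1 z (Finset.mem_insert_self _ _)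
          refine finish z hzA ?_ ?_
          · rintro rfl
            unfold Leaves at hz
            omega
          · unfold Leaves Compat at *
            simp only at *
            omega
    obtain ⟨e, he, heA⟩ := h.exists_accepts hK (by omega) ⟨lo + (hi - lo) / 2, by omega⟩
    have hle := heA.1 e (Finset.mem_insert_self _ _)
    by_cases hl : Leaves e lo hi
    · exact ⟨e, hl, heA⟩
    · have he' : (e.1 : ℕ) = lo + (hi - lo) / 2 ∨ (e.2 : ℕ) = lo + (hi - lo) / 2 :=
        he.imp (congrArg Fin.val) (congrArg Fin.val)
      refine enclose _ e rfl heA ?_ ?_ ?_ ?_ <;> unfold Leaves at hl <;> omega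

lemma no_bracket_strategy {k : ℕ} (hn : n % 2 = 1) (hk : n < 2 ^ k) :
    ¬ Strategy (bracketFormula n) (2 * k + 3) Ok := by
  intro h
  obtain ⟨z, hz, -⟩ := h.exists_leaves k ∅ 0 n ⟨by simp, by simpa [joinedSet] using h.empty⟩
    (by simp) (by omega) le_rfl (by omega)
  unfold Leaves at hz
  omega

end Search

lemma bracketCount_pos {n : ℕ} (hn : 0 < n) : 0 < bracketCount n := by
  have : SoundTriple n fun _ => joined ⟨0, hn⟩ ⟨0, hn⟩ := by
    intro K hK
    refine ⟨0, fun h => ?_⟩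
    rcases fals_joined h with h | h <;> exact absurd (hK.lt _ h) (by simp)
  obtain ⟨k, -⟩ := exists_bracketClause this
  exact k.pos

/-- The lifted bracket formula has quasipolynomial size refutations. -/
lemma exists_refutation_lifted {n k : ℕ} (hn : n % 2 = 1) (hk : n < 2 ^ k) :
    ∃ R : Refutation (Gad (BVar n) (bracketCount n)) (lifted (bracketClause n)),
      R.size ≤ (2 * Fintype.card (Gad (BVar n) (bracketCount n)) + 1) ^ (4 * k + 15) := by
  refine exists_refutation_of_no_strategy fun Ok h => ?_
  have hpos := bracketCount_pos (n := n) (by omega)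
  have h' : Strategy (lifted (bracketClause n) : Set _) (2 * (2 * k + 3) + 9) Ok := by
    convert h using 1
    ring
  exact no_bracket_strategy hn hk (h'.unlift ⟨0, by omega⟩)

/-! ### The family of formulas -/

lemma exists_root {e : ℕ} (he : e ≠ 0) (n : ℕ) : ∃ q, q ^ e ≤ n ∧ n < (q + 1) ^ e := by
  have hex : ∃ q, n < (q + 1) ^ e := ⟨n, (Nat.lt_succ_self n).trans_le (Nat.le_self_pow he _)⟩
  refine ⟨Nat.find hex, ?_, Nat.find_spec hex⟩
  rcases hq : Nat.find hex with _ | q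
  · simp [he]
  · exact not_lt.1 (Nat.find_min hex (by omega : q < Nat.find hex))

lemma exists_odd_root {N : ℕ} (hN : 0 < N) : ∃ n, n % 2 = 1 ∧ n ^ 9 ≤ N ∧ N < (n + 2) ^ 9 := by
  have hex : ∃ k, N < (2 * k + 3) ^ 9 :=
    ⟨N, (by omega : N < 2 * N + 3).trans_le (Nat.le_self_pow (by norm_num) _)⟩
  refine ⟨2 * Nat.find hex + 1, by omega, ?_, Nat.find_spec hex⟩
  rcases hq : Nat.find hex with _ | q
  · simpa using Nat.succ_le_of_lt hN
  · exact not_lt.1 (Nat.find_min hex (by omega : q < Nat.find hex))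

lemma bracketCount_le (n : ℕ) : bracketCount n ≤ (4 * n * (n + 1)) ^ 3 := by
  classical
  refine (Fintype.card_subtype_le _).trans (le_of_eq ?_)
  simp only [Fintype.card_fun, Fintype.card_prod, Fintype.card_fin, Fintype.card_bool]
  ring

lemma card_gad_le {n : ℕ} (hn : 30720 ≤ n) :
    Fintype.card (Gad (BVar n) (bracketCount n)) ≤ n ^ 9 := by
  have hV : 4 * n * (n + 1) ≤ 8 * n ^ 2 := by nlinarith
  have hm : bracketCount n ≤ (8 * n ^ 2) ^ 3 :=
    (bracketCount_le n).trans (Nat.pow_le_pow_left hV 3)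
  have h1 : 18 * n * (n + 1) + 24 ≤ 60 * n ^ 2 := by nlinarith
  have hcard : Fintype.card (Gad (BVar n) (bracketCount n)) =
      bracketCount n * (18 * n * (n + 1) + 24) := by
    simp only [Fintype.card_sum, Fintype.card_fun, Fintype.card_prod, Fintype.card_fin,
      Fintype.card_bool, Fintype.card_option]
    ring
  calc _ = _ := hcard
    _ ≤ (8 * n ^ 2) ^ 3 * (60 * n ^ 2) := Nat.mul_le_mul hm h1
    _ = 30720 * n ^ 8 := by ring
    _ ≤ n * n ^ 8 := Nat.mul_le_mul_right _ hn
    _ = n ^ 9 := by ring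

/-- The formula on `N` variables together with its upper and lower bounds. -/
lemma exists_formula (N : ℕ) : ∃ F : Finset (Clause (Fin N)),
    (∀ c ∈ F, c.card ≤ 3) ∧ Unsat (F : Set (Clause (Fin N))) ∧
    (30722 ^ 9 ≤ N → ∃ n, N < (n + 2) ^ 9 ∧ n ≤ N ∧
      (∀ k, n < 2 ^ k → ∃ R : Refutation (Fin N) (F : Set (Clause (Fin N))),
        R.size ≤ (2 * N + 1) ^ (4 * k + 15)) ∧
      ∀ R : Refutation (Fin N) (F : Set (Clause (Fin N))), ∀ w E l r, 168 * r ≤ w + 1 →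
        (w + 1) ^ l * (2 * w * E + 4) ≤ n → DepthLE R (E ^ l) → 64 ^ r ≤ R.size * 63 ^ r) := by
  by_cases hN : 30722 ^ 9 ≤ N
  swap
  · refine ⟨{∅}, by simp, fun α => ⟨∅, by simp, by simp [SatC]⟩, fun h => absurd h hN⟩
  obtain ⟨n, hodd, hn, hn'⟩ := exists_odd_root (lt_of_lt_of_le (by norm_num) hN)
  have hbig : 30720 ≤ n := by
    have := lt_of_pow_lt_pow_left₀ 9 (Nat.zero_le _) (hN.trans_lt hn')
    omega
  have hcard := (card_gad_le hbig).trans hn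
  obtain ⟨e⟩ : Nonempty (Gad (BVar n) (bracketCount n) ↪ Fin N) :=
    Function.Embedding.nonempty_of_card_le (by simpa using hcard)
  have hup : ∀ k, n < 2 ^ k → ∃ R : Refutation (Fin N)
      (((lifted (bracketClause n)).image (mapClause e) : Finset _) : Set (Clause (Fin N))),
        R.size ≤ (2 * N + 1) ^ (4 * k + 15) := by
    intro k hk
    obtain ⟨R, hR⟩ := exists_refutation_lifted hodd hk
    obtain ⟨R', hR'⟩ := R.exists_map e
      (G := (((lifted (bracketClause n)).image (mapClause e) : Finset _) : Set (Clause (Fin N))))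
      fun c hc => Finset.mem_coe.2 (Finset.mem_image_of_mem _ hc)
    refine ⟨R', ?_⟩
    rw [hR']
    exact hR.trans (Nat.pow_le_pow_left (by omega) _)
  refine ⟨(lifted (bracketClause n)).image (mapClause e), ?_, ?_, fun _ => ⟨n, hn',
    (Nat.le_self_pow (by norm_num) n).trans hn, hup, ?_⟩⟩
  · intro c hc
    obtain ⟨c₀, hc₀, rfl⟩ := Finset.mem_image.1 hc
    rw [mapClause, Finset.card_map]
    exact card_le_three_of_mem_lifted hc₀
  · obtain ⟨R, -⟩ := hup n Nat.lt_two_pow_self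
    exact R.unsat
  · intro R w E l r hr hw hd
    refine size_lower_bound e (fun c hc => ?_) R hr hd (alive_empty hodd hw)
    obtain ⟨c₀, hc₀, rfl⟩ := Finset.mem_image.1 (Finset.mem_coe.1 hc)
    exact ⟨c₀, hc₀, rfl⟩

lemma card_le_of_width_three {N : ℕ} (hN : 2 ≤ N) {F : Finset (Clause (Fin N))}
    (h : ∀ c ∈ F, c.card ≤ 3) : F.card ≤ N ^ 9 := by
  calc F.card ≤ (Finset.univ.filter fun c : Clause (Fin N) => c.card ≤ 3).card :=
        Finset.card_le_card fun c hc => Finset.mem_filter.2 ⟨Finset.mem_univ _, h c hc⟩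
    _ ≤ (2 * N + 1) ^ 3 := by simpa using card_narrow_clauses_le (X := Fin N) 3
    _ ≤ (N ^ 3) ^ 3 := Nat.pow_le_pow_left (by nlinarith [Nat.mul_le_mul hN hN]) 3
    _ = N ^ 9 := by ring

lemma size_upper_bound {N n s : ℕ} (hN : 3 ≤ N) (hn : n ≤ N)
    (hs : s ≤ (2 * N + 1) ^ (4 * (Nat.log 2 n + 1) + 15)) :
    (s : ℝ) ≤ (N : ℝ) ^ (54 * Real.log N) := by
  set t := Nat.log 2 n
  have hN0 : (0 : ℝ) < N := by positivity
  have hlog : 1 ≤ Real.log N := by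
    rw [Real.le_log_iff_exp_le hN0]
    have : (3 : ℝ) ≤ N := by exact_mod_cast hN
    linarith [Real.exp_one_lt_d9]
  have ht : (t : ℝ) ≤ 2 * Real.log N := by
    have h1 : 2 ^ t ≤ N := by
      rcases Nat.eq_zero_or_pos n with h0 | h0
      · simp [t, h0]
        omega
      · exact (Nat.pow_log_le_self 2 h0.ne').trans hn
    have h2 : (2 : ℝ) ^ t ≤ N := by exact_mod_cast h1
    have h3 := Real.log_le_log (by positivity) h2
    rw [Real.log_pow] at h3
    have h4 : (t : ℝ) * (1 / 2) ≤ t * Real.log 2 :=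
      mul_le_mul_of_nonneg_left (by linarith [Real.log_two_gt_d9]) (Nat.cast_nonneg t)
    linarith
  have h1 : s ≤ N ^ (2 * (4 * (t + 1) + 15)) := by
    rw [pow_mul]
    have hsq : 2 * N + 1 ≤ N ^ 2 := by
      clear hs
      nlinarith
    exact hs.trans (Nat.pow_le_pow_left hsq _)
  calc (s : ℝ) ≤ (N : ℝ) ^ (2 * (4 * (t + 1) + 15)) := by exact_mod_cast h1
    _ = (N : ℝ) ^ ((2 * (4 * (t + 1) + 15) : ℕ) : ℝ) := (Real.rpow_natCast _ _).symm
    _ ≤ (N : ℝ) ^ (54 * Real.log N) := by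
        refine Real.rpow_le_rpow_of_exponent_le (by exact_mod_cast (by omega : 1 ≤ N)) ?_
        push_cast
        linarith

lemma two_pow_le_of_ratio {p s : ℕ} (h : 64 ^ (63 * p) ≤ s * 63 ^ (63 * p)) : 2 ^ p ≤ s := by
  rw [pow_mul, pow_mul] at h
  refine Nat.le_of_mul_le_mul_right (le_trans ?_ h) (by positivity : 0 < (63 ^ 63) ^ p)
  rw [← mul_pow]
  exact Nat.pow_le_pow_left (by norm_num) p

/-- The choice of parameters in the lower bound. -/
lemma two_rpow_le_size {N n q L s : ℕ} {c : ℝ} (hL : 72 * c ≤ L) (hL2 : 2 ≤ L)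
    (hN : N < (n + 2) ^ 9) (hn : n ≤ N) (hq : q ^ (4 * L) ≤ n) (hq' : n < (q + 1) ^ (4 * L))
    (hq0 : 21168 ^ 2 ≤ q) {d : ℕ} (hd : (d : ℝ) ≤ (N : ℝ) ^ c)
    (hs : ∀ w E l r, 168 * r ≤ w + 1 → (w + 1) ^ l * (2 * w * E + 4) ≤ n → d ≤ E ^ l →
      64 ^ r ≤ s * 63 ^ r) :
    (2 : ℝ) ^ ((N : ℝ) ^ (1 / (288 * L) : ℝ)) ≤ s := by
  have hq2 : 2 ≤ q := le_trans (by norm_num) hq0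
  have hn2 : 2 ≤ n := hq2.trans ((Nat.le_self_pow (by omega) q).trans hq)
  have hNq : N ≤ q ^ (144 * L) := by
    have h1 : n ≤ q ^ (8 * L) := by
      refine hq'.le.trans ((Nat.pow_le_pow_left (by nlinarith : q + 1 ≤ q ^ 2) _).trans (le_of_eq ?_))
      rw [← pow_mul]
      congr 1
      ring
    calc N ≤ (n + 2) ^ 9 := hN.le
      _ ≤ (n ^ 2) ^ 9 := Nat.pow_le_pow_left (by nlinarith) 9
      _ = n ^ 18 := by ring
      _ ≤ (q ^ (8 * L)) ^ 18 := Nat.pow_le_pow_left h1 18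
      _ = q ^ (144 * L) := by rw [← pow_mul]; congr 1; ring
  have hq1R : (1 : ℝ) ≤ q := by exact_mod_cast (by omega : 1 ≤ q)
  have hNqR : (N : ℝ) ≤ (q : ℝ) ^ ((144 * L : ℕ) : ℝ) := by
    rw [Real.rpow_natCast]
    exact_mod_cast hNq
  have hdq : d ≤ (q ^ (2 * L)) ^ L := by
    have hNc : (N : ℝ) ^ c ≤ (q : ℝ) ^ ((2 * L * L : ℕ) : ℝ) := by
      rcases le_or_gt c 0 with hc | hc
      · exact (Real.rpow_le_one_of_one_le_of_nonpos (by exact_mod_cast (by omega : 1 ≤ N)) hc).trans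
          (Real.one_le_rpow hq1R (Nat.cast_nonneg _))
      · refine (Real.rpow_le_rpow (Nat.cast_nonneg _) hNqR hc.le).trans ?_
        rw [← Real.rpow_mul (by linarith)]
        refine Real.rpow_le_rpow_of_exponent_le hq1R ?_
        push_cast
        nlinarith [(Nat.cast_nonneg L : (0 : ℝ) ≤ L)]
    have := hd.trans hNc
    rw [Real.rpow_natCast] at this
    rw [← pow_mul]
    exact_mod_cast this
  have hparam : (q - 1 + 1) ^ L * (2 * (q - 1) * q ^ (2 * L) + 4) ≤ n := by
    rw [Nat.sub_add_cancel (by omega)]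
    refine le_trans ?_ hq
    have h4 : 4 ≤ 2 * q ^ (2 * L) := by
      have := (Nat.le_self_pow (by omega : 2 * L ≠ 0) q)
      omega
    calc q ^ L * (2 * (q - 1) * q ^ (2 * L) + 4)
        ≤ q ^ L * (2 * (q - 1) * q ^ (2 * L) + 2 * q ^ (2 * L)) := by gcongr
      _ = 2 * q ^ L * q ^ (2 * L) * (q - 1 + 1) := by ring
      _ = 2 * q ^ L * q ^ (2 * L) * q := by rw [Nat.sub_add_cancel (by omega)]
      _ ≤ q * q ^ L * q ^ (2 * L) * q := by gcongr
      _ = q ^ (3 * L + 2) := by ring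
      _ ≤ q ^ (4 * L) := Nat.pow_le_pow_right (by omega) (by omega)
  set p := q / 10584 with hp
  have hsize := two_pow_le_of_ratio (p := p) (hs (q - 1) (q ^ (2 * L)) L (63 * p)
    (by omega) hparam hdq)
  have hpN : (N : ℝ) ^ (1 / (288 * L) : ℝ) ≤ p := by
    have h1 : (N : ℝ) ^ (1 / (288 * L) : ℝ) ≤ √q := by
      refine (Real.rpow_le_rpow (Nat.cast_nonneg _) hNqR (by positivity)).trans (le_of_eq ?_)
      rw [← Real.rpow_mul (by linarith), Real.sqrt_eq_rpow]
      congr 1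
      have : (L : ℝ) ≠ 0 := by positivity
      push_cast
      field_simp
      norm_num
    have h2 : (21168 : ℝ) ≤ √q := by
      refine Real.le_sqrt_of_sq_le ?_
      exact_mod_cast hq0
    have h3 := Real.mul_self_sqrt (by linarith : (0 : ℝ) ≤ q)
    have h4 : (q : ℝ) ≤ 10584 * p + 10584 := by
      exact_mod_cast (by omega : q ≤ 10584 * p + 10584)
    nlinarith
  calc (2 : ℝ) ^ ((N : ℝ) ^ (1 / (288 * L) : ℝ)) ≤ (2 : ℝ) ^ (p : ℝ) :=
        Real.rpow_le_rpow_of_exponent_le (by norm_num) hpN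
    _ = (2 : ℝ) ^ p := Real.rpow_natCast _ _
    _ ≤ s := by exact_mod_cast hsize

/-- Supercritical size-depth tradeoff for resolution, witnessed by a
family of unsatisfiable 3-CNF formulas with polynomially many clauses. -/
theorem resolution_supercritical_tradeoff :
    ∃ a : ℝ, 0 < a ∧
    ∃ F : (N : ℕ) → Finset (Clause (Fin N)),
      (∀ N, ∀ C ∈ F N, C.card ≤ 3) ∧
      (∀ N, Unsat (↑(F N) : Set (Clause (Fin N)))) ∧
      (∃ b : ℕ, ∀ N, 2 ≤ N → (F N).card ≤ N ^ b) ∧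
      (∃ N₀ : ℕ, ∀ N ≥ N₀, ∃ R : Refutation (Fin N) (↑(F N) : Set (Clause (Fin N))),
        (R.size : ℝ) ≤ (N : ℝ) ^ (a * Real.log N)) ∧
      (∀ c : ℝ, 0 < c → ∃ ε : ℝ, 0 < ε ∧ ∃ N₀ : ℕ, ∀ N ≥ N₀,
        ∀ R : Refutation (Fin N) (↑(F N) : Set (Clause (Fin N))),
          ∀ d : ℕ, DepthLE R d → (d : ℝ) ≤ (N : ℝ) ^ c →
            (2 : ℝ) ^ ((N : ℝ) ^ ε) ≤ (R.size : ℝ)) := by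
  choose F hF3 hFu hF using exists_formula
  refine ⟨54, by norm_num, F, hF3, hFu, ⟨9, fun N hN => card_le_of_width_three hN (hF3 N)⟩,
    ⟨30722 ^ 9, fun N hN => ?_⟩, fun c hc => ?_⟩
  · obtain ⟨n, -, hn, hup, -⟩ := hF N hN
    obtain ⟨R, hR⟩ := hup _ (Nat.lt_pow_succ_log_self one_lt_two n)
    exact ⟨R, size_upper_bound (le_trans (by norm_num) hN) hn hR⟩
  · obtain ⟨L, hL, hL2⟩ : ∃ L : ℕ, 72 * c ≤ L ∧ 2 ≤ L :=
      ⟨max ⌈72 * c⌉₊ 2, (Nat.le_ceil _).trans (by exact_mod_cast le_max_left _ _), le_max_right _ _⟩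
    refine ⟨1 / (288 * L), by positivity, max (30722 ^ 9) (((21168 ^ 2) ^ (4 * L) + 2) ^ 9),
      fun N hN R d hd hdN => ?_⟩
    obtain ⟨n, hn', hn, -, hlow⟩ := hF N ((le_max_left _ _).trans hN)
    have hbig : (21168 ^ 2) ^ (4 * L) ≤ n := by
      have := lt_of_pow_lt_pow_left₀ 9 (Nat.zero_le _) (((le_max_right _ _).trans hN).trans_lt hn')
      omega
    obtain ⟨q, hq, hq'⟩ := exists_root (by omega : 4 * L ≠ 0) n
    have hq0 : 21168 ^ 2 ≤ q :=
      Nat.lt_succ_iff.1 (lt_of_pow_lt_pow_left₀ (4 * L) (Nat.zero_le _) (hbig.trans_lt hq'))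
    refine two_rpow_le_size hL hL2 hn' hn hq hq' hq0 hdN fun w E l r hr hw hdE => ?_
    obtain ⟨h, hh, hprem⟩ := hd
    exact hlow R w E l r hr hw ⟨h, fun i => (hh i).trans hdE, hprem⟩

end Paper
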